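/- arXiv:1205.4486 — 2 statements merged into one kernel-verified Lean document; each statement's English description precedes it below -/
import Mathlib

section
/- Let R be a commutative noetherian semilocal ring and suppose M is a finitely generated faithful R-module such that End_R(M) has finite global dimension (i.e., M gives a non-commutative resolution). Let C_M be the subcategory of finitely generated R-modules X with Supp(X) ⊆ NG(M). Then the quotient K_0(R)/⟨C_M⟩ of the Grothendieck group of mod R by the subgroup generated by classes of modules in C_M is a finitely generated abelian group. -/
open TensorProduct Function

section EvalMachinery

variable (R : Type) [CommRing R] (M : Type) [AddCommGroup M] [Module R M]
variable (X : Type) [AddCommGroup X] [Module R X]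

/-- The relations defining `M ⊗_{End_R M} Hom_R(M, X)` as a quotient of
`M ⊗[R] Hom_R(M, X)`: for `g ∈ End_R(M)` we identify `g m ⊗ f` and `m ⊗ (f ∘ g)`. -/
def endRelations : Submodule R (M ⊗[R] (M →ₗ[R] X)) :=
  Submodule.span R {z | ∃ (g : Module.End R M) (m : M) (f : M →ₗ[R] X),
    z = g m ⊗ₜ[R] f - m ⊗ₜ[R] (f ∘ₗ g)}

/-- The tensor product `M ⊗_{E} Hom_R(M, X)`, where `E = End_R(M)`. -/
abbrev TensorOverEnd := (M ⊗[R] (M →ₗ[R] X)) ⧸ endRelations R M X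

/-- The natural evaluation map `M ⊗_E Hom_R(M, X) → X`, `m ⊗ f ↦ f m`.
For `X = R` this is the map `a_M`. -/
noncomputable def evalMap : TensorOverEnd R M X →ₗ[R] X :=
  Submodule.liftQ _ (TensorProduct.lift LinearMap.applyₗ) (by
    rw [endRelations, Submodule.span_le]
    rintro z ⟨g, m, f, rfl⟩
    simp [SetLike.mem_coe, LinearMap.mem_ker])

/-- The non-generating locus `NG(M)`: the support of the cokernel of
`a_M : M ⊗_E Hom_R(M,R) → R`. -/
noncomputable def NG : Set (PrimeSpectrum R) :=
  Module.support R (R ⧸ LinearMap.range (evalMap R M R))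

end EvalMachinery
section GlobalDimension

open Function

/-- `ProjDimLE A n M` says that the `A`-module `M` admits a projective resolution of
length at most `n`. -/
inductive ProjDimLE (A : Type) [Ring A] : ℕ → ModuleCat.{0} A → Prop
  | proj (M : ModuleCat.{0} A) (h : Module.Projective A M) : ProjDimLE A 0 M
  | step (n : ℕ) (M P : ModuleCat.{0} A) (hP : Module.Projective A P)
      (f : P →ₗ[A] M) (hf : Surjective f)
      (h : ProjDimLE A n (ModuleCat.of A (LinearMap.ker f))) : ProjDimLE A (n + 1) M

/-- A ring has finite global dimension if there is a uniform finite bound on the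
projective dimension of all (left) modules. -/
def HasFiniteGlobalDim (A : Type) [Ring A] : Prop :=
  ∃ n : ℕ, ∀ M : ModuleCat.{0} A, ProjDimLE A n M

end GlobalDimension
section K0

open Function

/-- The (bundled) finitely generated modules over a ring `A`. -/
def FGModuleClass (A : Type) [Ring A] : Type 1 :=
  {M : ModuleCat.{0} A // Module.Finite A M}

/-- The subgroup of relations coming from short exact sequences `0 → M → N → P → 0`
of finitely generated modules: `[N] - [M] - [P]`. -/
def K0Relations (A : Type) [Ring A] : AddSubgroup (FreeAbelianGroup (FGModuleClass A)) :=
  AddSubgroup.closure {x | ∃ (M N P : FGModuleClass A)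
    (f : (M.1 : Type) →ₗ[A] (N.1 : Type)) (g : (N.1 : Type) →ₗ[A] (P.1 : Type)),
    Injective f ∧ Surjective g ∧ LinearMap.range f = LinearMap.ker g ∧
    x = FreeAbelianGroup.of N - FreeAbelianGroup.of M - FreeAbelianGroup.of P}

/-- The Grothendieck group `K₀` of the abelian category of finitely generated
`A`-modules: the free abelian group on finitely generated modules modulo the
relations coming from short exact sequences. -/
abbrev K0 (A : Type) [Ring A] : Type 1 :=
  FreeAbelianGroup (FGModuleClass A) ⧸ K0Relations A

end K0

/-- The subgroup of `K₀(mod R)` generated by the classes of finitely generated modules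
supported on the non-generating locus `NG(M)`. -/
noncomputable def CMSubgroup (R : Type) [CommRing R]
    (M : Type) [AddCommGroup M] [Module R M] : AddSubgroup (K0 R) :=
  AddSubgroup.closure {x | ∃ X : FGModuleClass R,
    Module.support R X.1 ⊆ NG R M ∧ x = QuotientAddGroup.mk (FreeAbelianGroup.of X)}

section ProjectiveDimension

open CategoryTheory

variable {A : Type} [Ring A]

lemma ProjDimLE.hasProjectiveDimensionLT {n : ℕ} {M : ModuleCat.{0} A} (h : ProjDimLE A n M) :
    HasProjectiveDimensionLT M (n + 1) := by
  induction h with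
  | proj M h =>
    have : Projective M := (IsProjective.iff_projective M).1 h
    infer_instance
  | step n M P hP f hf h ih =>
    have : Projective P := (IsProjective.iff_projective P).1 hP
    exact (LinearMap.shortExact_shortComplexKer hf).hasProjectiveDimensionLT_X₃ (n + 1) ih
      inferInstance

lemma hasProjectiveDimensionLT_ker {P N : Type} [AddCommGroup P] [Module A P] [AddCommGroup N]
    [Module A N] [Module.Projective A P] {f : P →ₗ[A] N} (hf : Surjective f) {n : ℕ}
    (h : HasProjectiveDimensionLT (ModuleCat.of A N) (n + 2)) :
    HasProjectiveDimensionLT (ModuleCat.of A (LinearMap.ker f)) (n + 1) := by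
  have hP : Projective (ModuleCat.of A P) := (IsProjective.iff_projective P).1 inferInstance
  exact ((LinearMap.shortExact_shortComplexKer hf).hasProjectiveDimensionLT_X₃_iff n hP).1 h

end ProjectiveDimension

section K0Classes

open CategoryTheory

variable {A : Type} [Ring A]

/-- The class in `K₀(mod A)` of a finitely generated module. -/
noncomputable def K0.cls (A : Type) [Ring A] (N : Type) [AddCommGroup N] [Module A N]
    [h : Module.Finite A N] : K0 A :=
  QuotientAddGroup.mk (FreeAbelianGroup.of ⟨ModuleCat.of A N, h⟩)

variable {N₁ N₂ N₃ : Type} [AddCommGroup N₁] [Module A N₁] [Module.Finite A N₁]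
  [AddCommGroup N₂] [Module A N₂] [Module.Finite A N₂]
  [AddCommGroup N₃] [Module A N₃] [Module.Finite A N₃]

lemma K0.cls_eq_add (f : N₁ →ₗ[A] N₂) (g : N₂ →ₗ[A] N₃) (hf : Injective f) (hg : Surjective g)
    (hfg : LinearMap.range f = LinearMap.ker g) :
    K0.cls A N₂ = K0.cls A N₁ + K0.cls A N₃ := by
  rw [← sub_eq_zero, ← sub_sub, K0.cls, K0.cls, K0.cls, ← QuotientAddGroup.mk_sub,
    ← QuotientAddGroup.mk_sub, QuotientAddGroup.eq_zero_iff]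
  exact AddSubgroup.subset_closure ⟨_, _, _, f, g, hf, hg, hfg, rfl⟩

lemma K0.cls_eq_zero [Subsingleton N₁] : K0.cls A N₁ = 0 := by
  have := K0.cls_eq_add (0 : N₁ →ₗ[A] N₁) (0 : N₁ →ₗ[A] N₁) (injective_of_subsingleton _)
    (surjective_to_subsingleton _) (Subsingleton.elim _ _)
  simpa using this

lemma K0.cls_congr (e : N₁ ≃ₗ[A] N₂) : K0.cls A N₁ = K0.cls A N₂ := by
  have := K0.cls_eq_add (e : N₁ →ₗ[A] N₂) (0 : N₂ →ₗ[A] PUnit.{1}) e.injective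
    (surjective_to_subsingleton _) (by simp)
  rw [this, K0.cls_eq_zero (N₁ := PUnit.{1}), add_zero]

lemma K0.cls_prod : K0.cls A (N₁ × N₂) = K0.cls A N₁ + K0.cls A N₂ :=
  K0.cls_eq_add (LinearMap.inl A N₁ N₂) (LinearMap.snd A N₁ N₂) LinearMap.inl_injective
    LinearMap.snd_surjective (LinearMap.range_inl A N₁ N₂)

lemma K0.eq_top_of_cls_mem {H : AddSubgroup (K0 A)}
    (hH : ∀ (N : Type) [AddCommGroup N] [Module A N] [Module.Finite A N], K0.cls A N ∈ H) :
    H = ⊤ := by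
  rw [eq_top_iff]
  rintro x -
  induction x using QuotientAddGroup.induction_on with
  | H z =>
    induction z using FreeAbelianGroup.induction_on with
    | zero => exact H.zero_mem
    | of X => have := X.2; exact hH X.1
    | neg X hX => exact H.neg_mem hX
    | add x y hx hy => exact H.add_mem hx hy

/-- Over a left noetherian ring, the class of a finitely generated module of finite projective
dimension is a combination of classes of finitely generated projective modules. -/
lemma K0.cls_mem_of_hasProjectiveDimensionLT [IsNoetherianRing A] {H : AddSubgroup (K0 A)}
    (hH : ∀ (P : Type) [AddCommGroup P] [Module A P] [Module.Finite A P] [Module.Projective A P],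
      K0.cls A P ∈ H) (n : ℕ) (N : Type) [AddCommGroup N] [Module A N] [Module.Finite A N]
    (h : HasProjectiveDimensionLT (ModuleCat.of A N) (n + 1)) : K0.cls A N ∈ H := by
  induction n generalizing N with
  | zero =>
    have : Projective (ModuleCat.of A N) :=
      projective_iff_hasProjectiveDimensionLT_one.2 h
    have : Module.Projective A N := (IsProjective.iff_projective N).2 this
    exact hH N
  | succ n ih =>
    obtain ⟨k, f, hf⟩ := Module.Finite.exists_fin' A N
    have := K0.cls_eq_add (LinearMap.ker f).subtype f (Submodule.injective_subtype _) hf (by simp)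
    rw [← sub_eq_iff_eq_add'] at this
    rw [← this]
    exact H.sub_mem (hH _) (ih _ (hasProjectiveDimensionLT_ker hf h))

end K0Classes

section SemisimpleTop

variable {A : Type} [Ring A] {ι : Type} (S : ι → Type) [∀ i, AddCommGroup (S i)]
  [∀ i, Module A (S i)]

/-- The direct sum of `a i` copies of `S i`, for all `i`. -/
abbrev MultSum (a : ι → ℕ) : Type := (p : Σ i, Fin (a i)) → S p.1

/-- `HasTop A S P a` says that `P` maps onto the direct sum of `a i` copies of `S i` with kernel
inside the radical of `P`. -/
def HasTop (A : Type) [Ring A] [∀ i, Module A (S i)] (P : Type) [AddCommGroup P] [Module A P]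
    (a : ι → ℕ) : Prop :=
  ∃ f : P →ₗ[A] MultSum S a, Surjective f ∧ LinearMap.ker f ≤ Module.jacobson A P

variable {S} {P Q : Type} [AddCommGroup P] [Module A P] [AddCommGroup Q] [Module A Q]

variable (A S) in
/-- Multiplicities add up under direct sums. -/
def multSumAddEquiv (a b : ι → ℕ) : MultSum S (a + b) ≃ₗ[A] MultSum S a × MultSum S b where
  toFun x := (fun p ↦ x ⟨p.1, Fin.castAdd (b p.1) p.2⟩, fun p ↦ x ⟨p.1, Fin.natAdd (a p.1) p.2⟩)
  map_add' _ _ := rfl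
  map_smul' _ _ := rfl
  invFun y p := Fin.addCases (motive := fun _ ↦ S p.1) (fun j ↦ y.1 ⟨p.1, j⟩)
    (fun j ↦ y.2 ⟨p.1, j⟩) p.2
  left_inv x := by
    funext ⟨i, j⟩
    refine Fin.addCases (fun j ↦ ?_) (fun j ↦ ?_) j <;> simp
  right_inv y := by
    ext p <;> simp

lemma HasTop.prod {a b : ι → ℕ} (hP : HasTop S A P a) (hQ : HasTop S A Q b) :
    HasTop S A (P × Q) (a + b) := by
  obtain ⟨f, hf, hf'⟩ := hP
  obtain ⟨g, hg, hg'⟩ := hQ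
  refine ⟨(multSumAddEquiv A S a b).symm.toLinearMap ∘ₗ f.prodMap g,
    (multSumAddEquiv A S a b).symm.surjective.comp (hf.prodMap hg), ?_⟩
  rintro ⟨x, y⟩ hxy
  have hxy : f x = 0 ∧ g y = 0 := by simpa using hxy
  have hx : (x, 0) ∈ Module.jacobson A (P × Q) :=
    Module.le_comap_jacobson (LinearMap.inl A P Q) (hf' hxy.1)
  have hy : (0, y) ∈ Module.jacobson A (P × Q) :=
    Module.le_comap_jacobson (LinearMap.inr A P Q) (hg' hxy.2)
  simpa using add_mem hx hy

/-- The radical of a finitely generated module is superfluous. -/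
lemma surjective_of_comp_of_ker_le_jacobson {T : Type} [AddCommGroup T] [Module A T]
    [Module.Finite A P] {f : P →ₗ[A] T} (hf : LinearMap.ker f ≤ Module.jacobson A P)
    {g : Q →ₗ[A] P} (hg : Surjective (f ∘ₗ g)) : Surjective g := by
  rw [← LinearMap.range_eq_top]
  by_contra h
  obtain ⟨m, hm, hgm⟩ := (eq_top_or_exists_le_coatom (LinearMap.range g)).resolve_left h
  refine hm.1 (eq_top_iff.2 fun x _ ↦ ?_)
  obtain ⟨y, hy⟩ := hg (f x)
  have hk : x - g y ∈ LinearMap.ker f := by simp [← hy]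
  have h1 : x - g y ∈ m := (sInf_le hm : Module.jacobson A P ≤ m) (hf hk)
  simpa using add_mem h1 (hgm ⟨y, rfl⟩)

/-- Projective covers are unique. -/
lemma HasTop.nonempty_linearEquiv [Module.Finite A P] [Module.Projective A P] [Module.Finite A Q]
    [Module.Projective A Q] {a : ι → ℕ} (hP : HasTop S A P a) (hQ : HasTop S A Q a) :
    Nonempty (P ≃ₗ[A] Q) := by
  obtain ⟨f, hf, hf'⟩ := hP
  obtain ⟨g, hg, hg'⟩ := hQ
  obtain ⟨u, hu⟩ := Module.projective_lifting_property g f hg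
  have hu' : Surjective u := surjective_of_comp_of_ker_le_jacobson hg' (hu ▸ hf)
  obtain ⟨s, hs⟩ := Module.projective_lifting_property u LinearMap.id hu'
  have hs' : Surjective s := by
    refine surjective_of_comp_of_ker_le_jacobson hf' ?_
    rwa [← hu, LinearMap.comp_assoc, hs, LinearMap.comp_id]
  have hsi : Injective s := LeftInverse.injective (g := u) fun x ↦ LinearMap.congr_fun hs x
  exact ⟨(LinearEquiv.ofBijective s ⟨hsi, hs'⟩).symm⟩

lemma AddMonoidHom.fg_range_of_ker_le {F G L : Type*} [AddCommGroup F] [AddCommGroup G]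
    [AddCommGroup L] [Module.Finite ℤ L] (d : F →+ L) (h : F →+ G) (hdh : d.ker ≤ h.ker) :
    h.range.FG := by
  have : Module.Finite ℤ (F ⧸ LinearMap.ker d.toIntLinearMap) :=
    Module.Finite.equiv d.toIntLinearMap.quotKerEquivRange.symm
  have hle : LinearMap.ker d.toIntLinearMap ≤ LinearMap.ker h.toIntLinearMap := hdh
  have hr : (LinearMap.range ((LinearMap.ker d.toIntLinearMap).liftQ _ hle)).FG :=
    Module.Finite.iff_fg.1 inferInstance
  rw [Submodule.range_liftQ, Submodule.fg_iff_addSubgroup_fg] at hr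
  exact hr

/-- If every finitely generated projective module has a top which is a finite direct sum of
members of a fixed finite family, then the classes of finitely generated projective modules
generate a finitely generated group. -/
lemma K0.exists_fg_of_hasTop [Finite ι]
    (hS : ∀ (P : Type) [AddCommGroup P] [Module A P] [Module.Finite A P] [Module.Projective A P],
      ∃ a, HasTop S A P a) :
    ∃ H : AddSubgroup (K0 A), H.FG ∧ ∀ (P : Type) [AddCommGroup P] [Module A P]
      [Module.Finite A P] [Module.Projective A P], K0.cls A P ∈ H := by
  let Pr : Type 1 := {X : FGModuleClass A // Module.Projective A X.1}
  have fin (X : Pr) : Module.Finite A X.1.1 := X.1.2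
  have proj (X : Pr) : Module.Projective A X.1.1 := X.2
  choose a ha using fun X : Pr ↦ hS X.1.1
  let d : FreeAbelianGroup Pr →+ (ι → ℤ) := FreeAbelianGroup.lift fun X i ↦ (a X i : ℤ)
  let h : FreeAbelianGroup Pr →+ K0 A := FreeAbelianGroup.lift fun X ↦ K0.cls A X.1.1
  have key (x : FreeAbelianGroup Pr) : ∃ (P Q : Pr) (b c : ι → ℕ), HasTop S A P.1.1 b ∧
      HasTop S A Q.1.1 c ∧ d x = (fun i ↦ (b i : ℤ)) - (fun i ↦ (c i : ℤ)) ∧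
      h x = K0.cls A P.1.1 - K0.cls A Q.1.1 := by
    have sum (P Q : Pr) : ∃ Z : Pr, ∀ b c, HasTop S A P.1.1 b → HasTop S A Q.1.1 c →
        HasTop S A Z.1.1 (b + c) ∧ K0.cls A Z.1.1 = K0.cls A P.1.1 + K0.cls A Q.1.1 :=
      ⟨⟨⟨ModuleCat.of A (P.1.1 × Q.1.1), inferInstanceAs (Module.Finite A (P.1.1 × Q.1.1))⟩,
        inferInstanceAs (Module.Projective A (P.1.1 × Q.1.1))⟩,
        fun b c hb hc ↦ ⟨hb.prod hc, K0.cls_prod⟩⟩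
    let O : Pr := ⟨⟨ModuleCat.of A PUnit.{1}, inferInstanceAs (Module.Finite A PUnit.{1})⟩,
      inferInstanceAs (Module.Projective A PUnit.{1})⟩
    have hO : HasTop S A O.1.1 0 :=
      ⟨0, fun y ↦ ⟨0, funext fun p ↦ p.2.elim0⟩, fun x _ ↦ by
        rw [show x = 0 from Subsingleton.elim (α := PUnit) _ _]; exact zero_mem _⟩
    have hO' : K0.cls A O.1.1 = 0 := K0.cls_eq_zero (N₁ := PUnit.{1})
    induction x using FreeAbelianGroup.induction_on with
    | zero => exact ⟨O, O, 0, 0, hO, hO, by simp, by simp⟩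
    | of X =>
      refine ⟨X, O, a X, 0, ha X, hO, ?_, ?_⟩
      · simp only [d, FreeAbelianGroup.lift_apply_of]
        ext; simp
      · simp only [h, FreeAbelianGroup.lift_apply_of, hO', sub_zero]
    | neg X hX =>
      obtain ⟨P, Q, b, c, hb, hc, hd, hh⟩ := hX
      exact ⟨Q, P, c, b, hc, hb, by rw [map_neg, hd, neg_sub], by rw [map_neg, hh, neg_sub]⟩
    | add x y hx hy =>
      obtain ⟨P, Q, b, c, hb, hc, hd, hh⟩ := hx
      obtain ⟨P', Q', b', c', hb', hc', hd', hh'⟩ := hy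
      obtain ⟨Z, hZ⟩ := sum P P'
      obtain ⟨W, hW⟩ := sum Q Q'
      refine ⟨Z, W, b + b', c + c', (hZ _ _ hb hb').1, (hW _ _ hc hc').1, ?_, ?_⟩
      · rw [map_add, hd, hd']
        ext i
        simp only [Pi.add_apply, Pi.sub_apply, Nat.cast_add]
        ring
      · rw [map_add, hh, hh', (hZ _ _ hb hb').2, (hW _ _ hc hc').2]
        abel
  refine ⟨h.range, d.fg_range_of_ker_le h fun x hx ↦ ?_, fun P _ _ hP hP' ↦
    ⟨FreeAbelianGroup.of ⟨⟨ModuleCat.of A P, hP⟩, hP'⟩, by simp [h]⟩⟩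
  obtain ⟨P, Q, b, c, hb, hc, hd, hh⟩ := key x
  have hbc : b = c := by
    funext i
    rw [AddMonoidHom.mem_ker, hd] at hx
    simpa [sub_eq_zero] using congrFun hx i
  subst hbc
  obtain ⟨e⟩ := hb.nonempty_linearEquiv hc
  rw [AddMonoidHom.mem_ker, hh, K0.cls_congr e, sub_self]

end SemisimpleTop

section Semilocal

lemma isArtinianRing_quotient_jacobson {R : Type*} [CommRing R]
    (h : {I : Ideal R | I.IsMaximal}.Finite) : IsArtinianRing (R ⧸ Ring.jacobson R) := by
  have : Finite {I : Ideal R | I.IsMaximal} := h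
  have (I : {I : Ideal R | I.IsMaximal}) : I.1.IsMaximal := I.2
  have (I : {I : Ideal R | I.IsMaximal}) : IsSemisimpleRing (R ⧸ I.1) :=
    let _ := Ideal.Quotient.field I.1; inferInstance
  have : IsSemisimpleRing (R ⧸ Ring.jacobson R) := by
    rw [Ring.jacobson_eq_sInf_isMaximal, sInf_eq_iInf']
    exact (Ideal.quotientInfRingEquivPiQuotient _ fun I J ne ↦
      Ideal.isCoprime_of_isMaximal <| Subtype.coe_ne_coe.mpr ne).symm.isSemisimpleRing
  infer_instance

variable {R : Type*} [CommRing R] {A : Type} [Ring A] [Algebra R A]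

/-- The radical of `R` acts by zero on simple modules over a finite `R`-algebra. -/
lemma smul_eq_zero_of_mem_jacobson {N : Type*} [AddCommGroup N] [Module R N] [Module A N]
    [IsScalarTower R A N] [Module.Finite R N] [IsSimpleModule A N] {c : R}
    (hc : c ∈ Ring.jacobson R) (x : N) : c • x = 0 := by
  have := IsSimpleModule.nontrivial A N
  let φ : N →ₗ[A] N := Module.toModuleEnd A N c
  by_contra hx
  have hφ : φ ≠ 0 := fun h ↦ hx (LinearMap.congr_fun h x)
  have hs := (LinearMap.bijective_of_ne_zero hφ).2
  have hbot : (⊤ : Submodule R N) = ⊥ := by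
    refine Submodule.eq_bot_of_le_smul_of_le_jacobson_bot (Ideal.span {c}) ⊤ Module.Finite.fg_top
      (fun y _ ↦ ?_) ?_
    · obtain ⟨z, rfl⟩ := hs y
      exact Submodule.smul_mem_smul (Ideal.mem_span_singleton_self c) Submodule.mem_top
    · rw [Ideal.span_singleton_le_iff_mem, Ideal.jacobson_bot]
      exact hc
  exact hx ((Submodule.mem_bot R).1 (hbot ▸ Submodule.mem_top))

lemma smul_mem_jacobson {N : Type*} [AddCommGroup N] [Module R N] [Module A N]
    [IsScalarTower R A N] [Module.Finite R N] {c : R} (hc : c ∈ Ring.jacobson R) (x : N) :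
    c • x ∈ Module.jacobson A N := by
  rw [Module.jacobson, Submodule.mem_sInf]
  intro m hm
  have : IsSimpleModule A (N ⧸ m) := isSimpleModule_iff_isCoatom.2 hm
  have : Module.Finite R (N ⧸ m) := Module.Finite.of_surjective (m.mkQ.restrictScalars R)
    m.mkQ_surjective
  rw [← Submodule.Quotient.mk_eq_zero, Submodule.Quotient.mk_smul]
  exact smul_eq_zero_of_mem_jacobson (A := A) hc _

lemma isSemisimpleModule_quotient_jacobson (h : {I : Ideal R | I.IsMaximal}.Finite)
    {N : Type*} [AddCommGroup N] [Module R N] [Module A N]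
    [IsScalarTower R A N] [Module.Finite R N] :
    IsSemisimpleModule A (N ⧸ Module.jacobson A N) := by
  have := isArtinianRing_quotient_jacobson h
  have : Module.Finite R (N ⧸ Module.jacobson A N) :=
    Module.Finite.of_surjective ((Module.jacobson A N).mkQ.restrictScalars R)
      (Module.jacobson A N).mkQ_surjective
  have hann : Module.IsTorsionBySet R (N ⧸ Module.jacobson A N) (Ring.jacobson R : Set R) := by
    rintro x ⟨c, hc⟩
    obtain ⟨x, rfl⟩ := Submodule.Quotient.mk_surjective _ x
    change c • Submodule.Quotient.mk x = _
    rw [← Submodule.Quotient.mk_smul, Submodule.Quotient.mk_eq_zero]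
    exact smul_mem_jacobson hc x
  let := hann.module
  have : Module.Finite (R ⧸ Ring.jacobson R) (N ⧸ Module.jacobson A N) :=
    Module.Finite.of_restrictScalars_finite R _ _
  have : IsArtinian R (N ⧸ Module.jacobson A N) :=
    isArtinian_of_surjective_algebraMap (R := R ⧸ Ring.jacobson R) Ideal.Quotient.mk_surjective
  have : IsArtinian A (N ⧸ Module.jacobson A N) := isArtinian_of_tower R this
  exact (IsArtinian.isSemisimpleModule_iff_jacobson _ _).2 (Module.jacobson_quotient_jacobson _ _)

lemma exists_linearEquiv_pi_isSimpleModule (A : Type) [Ring A] (N : Type)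
    [AddCommGroup N] [Module A N] [IsSemisimpleModule A N] [Module.Finite A N] :
    ∃ (n : ℕ) (S : Fin n → Submodule A N), (∀ i, IsSimpleModule A (S i)) ∧
      Nonempty (N ≃ₗ[A] ∀ i, S i) := by
  obtain ⟨n, S, e, h⟩ := IsSemisimpleModule.exists_linearEquiv_fin_dfinsupp A N
  exact ⟨n, S, h, ⟨e.trans DFinsupp.linearEquivFunOnFintype⟩⟩

lemma exists_linearEquiv_of_isSimpleModule {n : ℕ} {S : Fin n → Type} [∀ i, AddCommGroup (S i)]
    [∀ i, Module A (S i)] [∀ i, IsSimpleModule A (S i)]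
    (e : (A ⧸ Module.jacobson A A) ≃ₗ[A] ∀ i, S i)
    (N : Type*) [AddCommGroup N] [Module A N] [IsSimpleModule A N] :
    ∃ i, Nonempty (N ≃ₗ[A] S i) := by
  have := IsSimpleModule.nontrivial A N
  obtain ⟨x, hx⟩ := exists_ne (0 : N)
  have hsurj := IsSimpleModule.toSpanSingleton_surjective A hx
  have hle : Module.jacobson A A ≤ LinearMap.ker (LinearMap.toSpanSingleton A N x) := by
    refine sInf_le (isSimpleModule_iff_isCoatom.1 ?_)
    exact .congr (LinearMap.quotKerEquivOfSurjective _ hsurj)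
  let g : (∀ i, S i) →ₗ[A] N := (Submodule.liftQ _ _ hle) ∘ₗ e.symm.toLinearMap
  have hg : g ≠ 0 := by
    intro h
    have := LinearMap.congr_fun h (e (Submodule.Quotient.mk 1))
    rw [LinearMap.comp_apply, LinearEquiv.coe_coe, e.symm_apply_apply, Submodule.liftQ_apply,
      LinearMap.toSpanSingleton_apply, one_smul] at this
    exact hx this
  have : ∃ i, g ∘ₗ LinearMap.single A S i ≠ 0 := by
    by_contra! h
    exact hg (LinearMap.pi_ext' fun i ↦ by simpa using h i)
  obtain ⟨i, hi⟩ := this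
  exact ⟨i, ⟨(LinearEquiv.ofBijective _ (LinearMap.bijective_of_ne_zero hi)).symm⟩⟩

lemma HasTop.exists_of_isSemisimpleModule {n : ℕ} {S : Fin n → Type} [∀ i, AddCommGroup (S i)]
    [∀ i, Module A (S i)] [∀ i, IsSimpleModule A (S i)]
    (e : (A ⧸ Module.jacobson A A) ≃ₗ[A] ∀ i, S i) (P : Type) [AddCommGroup P] [Module A P]
    [Module.Finite A P] [IsSemisimpleModule A (P ⧸ Module.jacobson A P)] :
    ∃ a, HasTop S A P a := by
  obtain ⟨k, S', hS', ⟨e'⟩⟩ := exists_linearEquiv_pi_isSimpleModule A (P ⧸ Module.jacobson A P)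
  choose c hc using fun j ↦ exists_linearEquiv_of_isSimpleModule e (S' j)
  let a (i : Fin n) : ℕ := Fintype.card {j // c j = i}
  let E : Fin k ≃ Σ i, Fin (a i) :=
    (Equiv.sigmaFiberEquiv c).symm.trans (Equiv.sigmaCongrRight fun i ↦ Fintype.equivFin _)
  have hE (p : Σ i, Fin (a i)) : Nonempty (S' (E.symm p) ≃ₗ[A] S p.1) := by
    obtain ⟨j, rfl⟩ := E.surjective p
    rw [E.symm_apply_apply]
    exact hc j
  let F : (P ⧸ Module.jacobson A P) ≃ₗ[A] MultSum S a :=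
    e'.trans ((LinearEquiv.piCongrLeft' A (fun j ↦ S' j) E).trans
      (LinearEquiv.piCongrRight fun p ↦ (hE p).some))
  refine ⟨a, F.toLinearMap ∘ₗ (Module.jacobson A P).mkQ,
    F.surjective.comp (Submodule.mkQ_surjective _), ?_⟩
  rw [LinearEquiv.ker_comp, Submodule.ker_mkQ]

/-- `K₀` of a finite algebra of finite global dimension over a noetherian semilocal ring is
finitely generated. -/
theorem K0.fg_of_hasFiniteGlobalDim [IsNoetherianRing R]
    (h : {I : Ideal R | I.IsMaximal}.Finite) [Module.Finite R A] (hA : HasFiniteGlobalDim A) :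
    AddGroup.FG (K0 A) := by
  have : IsNoetherianRing A := isNoetherian_of_tower R inferInstance
  have semisimple (P : Type) [AddCommGroup P] [Module A P] [Module.Finite A P] :
      IsSemisimpleModule A (P ⧸ Module.jacobson A P) := by
    let : Module R P := Module.compHom P (algebraMap R A)
    have : IsScalarTower R A P := ⟨fun r a x ↦ by
      rw [Algebra.smul_def, mul_smul]; rfl⟩
    have : Module.Finite R P := Module.Finite.trans A P
    exact isSemisimpleModule_quotient_jacobson h
  have := semisimple A
  obtain ⟨n, S, hS, ⟨e⟩⟩ := exists_linearEquiv_pi_isSimpleModule A (A ⧸ Module.jacobson A A)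
  obtain ⟨H, hH, hP⟩ := K0.exists_fg_of_hasTop (A := A) (S := fun i ↦ S i) fun P _ _ _ _ ↦ by
    have := semisimple P
    exact HasTop.exists_of_isSemisimpleModule e P
  obtain ⟨d, hd⟩ := hA
  have htop : H = ⊤ := K0.eq_top_of_cls_mem fun N _ _ _ ↦
    K0.cls_mem_of_hasProjectiveDimensionLT hP d N (hd _).hasProjectiveDimensionLT
  exact AddGroup.fg_def.2 (htop ▸ hH)

end Semilocal

section Comparison

variable {R : Type} [CommRing R] {M : Type} [AddCommGroup M] [Module R M]

lemma CMSubgroup.mk_cls_eq_zero {X : Type} [AddCommGroup X] [Module R X] [Module.Finite R X]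
    (h : ∀ (f : M →ₗ[R] R) (m : M) (x : X), f m • x = 0) :
    (QuotientAddGroup.mk (K0.cls R X) : K0 R ⧸ CMSubgroup R M) = 0 := by
  rw [QuotientAddGroup.eq_zero_iff]
  refine AddSubgroup.subset_closure ⟨_, fun p hp ↦ ?_, rfl⟩
  have hp : p ∈ Module.support R X := hp
  rw [Module.mem_support_iff'] at hp
  obtain ⟨x, hx⟩ := hp
  rw [NG, Module.mem_support_iff']
  refine ⟨Submodule.Quotient.mk 1, fun r hr h0 ↦ hx r hr ?_⟩
  rw [← Submodule.Quotient.mk_smul, Submodule.Quotient.mk_eq_zero, smul_eq_mul, mul_one] at h0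
  have hle : LinearMap.range (evalMap R M R) ≤
      LinearMap.ker (LinearMap.toSpanSingleton R X x) := by
    rintro _ ⟨z, rfl⟩
    obtain ⟨z, rfl⟩ := Submodule.Quotient.mk_surjective _ z
    induction z using TensorProduct.induction_on with
    | zero => simp
    | tmul m f => simpa [evalMap] using h f m x
    | add z w hz hw => rw [Submodule.Quotient.mk_add, map_add]; exact add_mem hz hw
  simpa using hle h0

/-- Two modules have the same class modulo `⟨C_M⟩` if there is a map between them whose kernel
and cokernel are killed by the trace ideal of `M`. -/
lemma CMSubgroup.mk_cls_eq [IsNoetherianRing R] {X Y : Type} [AddCommGroup X] [Module R X]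
    [Module.Finite R X] [AddCommGroup Y] [Module R Y] [Module.Finite R Y] (φ : X →ₗ[R] Y)
    (hker : ∀ (f : M →ₗ[R] R) (m : M) (x : X), φ x = 0 → f m • x = 0)
    (hrange : ∀ (f : M →ₗ[R] R) (m : M) (y : Y), f m • y ∈ LinearMap.range φ) :
    (QuotientAddGroup.mk (K0.cls R X) : K0 R ⧸ CMSubgroup R M) =
      QuotientAddGroup.mk (K0.cls R Y) := by
  have h1 := K0.cls_eq_add (LinearMap.ker φ).subtype φ.rangeRestrict
    (Submodule.injective_subtype _) φ.surjective_rangeRestrict (by simp)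
  have h2 := K0.cls_eq_add (LinearMap.range φ).subtype (LinearMap.range φ).mkQ
    (Submodule.injective_subtype _) (Submodule.mkQ_surjective _) (by simp)
  rw [h1, h2, QuotientAddGroup.mk_add, QuotientAddGroup.mk_add,
    CMSubgroup.mk_cls_eq_zero (X := LinearMap.ker φ), CMSubgroup.mk_cls_eq_zero
    (X := Y ⧸ LinearMap.range φ), zero_add, add_zero]
  · intro f m y
    obtain ⟨y, rfl⟩ := Submodule.Quotient.mk_surjective _ y
    rw [← Submodule.Quotient.mk_smul, Submodule.Quotient.mk_eq_zero]
    exact hrange f m y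
  · rintro f m ⟨x, hx⟩
    exact Subtype.ext (hker f m x hx)

lemma finite_linearMap [IsNoetherianRing R] [Module.Finite R M] {N : Type} [AddCommGroup N]
    [Module R N] [Module.Finite R N] : Module.Finite R (M →ₗ[R] N) := by
  obtain ⟨k, p, hp⟩ := Module.Finite.exists_fin' R M
  have : IsNoetherian R ((Fin k → R) →ₗ[R] N) :=
    isNoetherian_of_linearEquiv (LinearMap.lsum R (fun _ : Fin k ↦ R) R)
  exact Module.Finite.of_injective (LinearMap.lcomp R N p) fun φ ψ h ↦
    (LinearMap.cancel_right hp).1 h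

/-- The endomorphism `y ↦ f y • x`. -/
abbrev rankOne (f : M →ₗ[R] R) (x : M) : Module.End R M := f.smulRight x

/-- The map `x ↦ rankOne f x • n`. -/
def rankOneSMul {N : Type} [AddCommGroup N] [Module (Module.End R M) N] (f : M →ₗ[R] R) (n : N) :
    M →ₗ[Module.End R M] N where
  toFun x := rankOne f x • n
  map_add' x y := by
    rw [← add_smul]; congr 1; ext; simp [rankOne]
  map_smul' g x := by
    rw [RingHom.id_apply, ← mul_smul]; congr 1; ext; simp [rankOne]

lemma smul_apply_eq_rankOne_smul {N : Type} [AddCommGroup N] [Module R N]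
    [Module (Module.End R M) N] [IsScalarTower R (Module.End R M) N]
    (φ : M →ₗ[Module.End R M] N) (f : M →ₗ[R] R) (m x : M) :
    f m • φ x = rankOne f x • φ m := by
  rw [← φ.map_smul_of_tower, ← map_smul]
  rfl

/-- `Hom_{End_R(M)}(M, N)` as an `R`-module. -/
abbrev HomEnd (R M N : Type) [CommRing R] [AddCommGroup M] [Module R M] [AddCommGroup N]
    [Module (Module.End R M) N] : Type := M →ₗ[Module.End R M] N

lemma exists_comp_eq_smul {N N'' : Type} [AddCommGroup N]
    [Module (Module.End R M) N] [AddCommGroup N''] [Module R N''] [Module (Module.End R M) N'']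
    [IsScalarTower R (Module.End R M) N''] {q : N →ₗ[Module.End R M] N''} (hq : Surjective q)
    (f : M →ₗ[R] R) (m : M) (φ : HomEnd R M N'') : ∃ ψ : HomEnd R M N, q ∘ₗ ψ = f m • φ := by
  obtain ⟨n, hn⟩ := hq (φ m)
  refine ⟨rankOneSMul f n, LinearMap.ext fun x ↦ ?_⟩
  rw [LinearMap.smul_apply, smul_apply_eq_rankOne_smul, ← hn, ← map_smul]
  rfl

section Hom

variable {N N' N'' : Type} [AddCommGroup N] [Module R N] [Module (Module.End R M) N]
  [IsScalarTower R (Module.End R M) N] [AddCommGroup N'] [Module R N'] [Module (Module.End R M) N']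
  [IsScalarTower R (Module.End R M) N'] [AddCommGroup N''] [Module R N'']
  [Module (Module.End R M) N''] [IsScalarTower R (Module.End R M) N'']

instance [IsNoetherianRing R] [Module.Finite R M] [Module.Finite R N] :
    Module.Finite R (HomEnd R M N) := by
  have : Module.Finite R (M →ₗ[R] N) := finite_linearMap
  exact Module.Finite.of_injective
    (LinearMap.restrictScalarsₗ R (Module.End R M) M N R) (LinearMap.restrictScalars_injective R)

/-- Composition with an `End_R(M)`-linear map, as an `R`-linear map. -/
def HomEnd.map (q : N →ₗ[Module.End R M] N'') : HomEnd R M N →ₗ[R] HomEnd R M N'' where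
  toFun ψ := q ∘ₗ ψ
  map_add' ψ ψ' := LinearMap.comp_add _ _ _
  map_smul' r ψ := by
    ext x
    exact q.map_smul_of_tower r (ψ x)

variable [IsNoetherianRing R] [Module.Finite R M] [Module.Finite R N] [Module.Finite R N']
  [Module.Finite R N'']

/-- `Hom_{End_R(M)}(M, -)` is exact modulo `⟨C_M⟩`. -/
lemma mk_cls_homEnd_eq_add (i : N' →ₗ[Module.End R M] N) (q : N →ₗ[Module.End R M] N'')
    (hi : Injective i) (hq : Surjective q) (hiq : LinearMap.range i = LinearMap.ker q) :
    (QuotientAddGroup.mk (K0.cls R (HomEnd R M N)) : K0 R ⧸ CMSubgroup R M) =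
      QuotientAddGroup.mk (K0.cls R (HomEnd R M N')) +
        QuotientAddGroup.mk (K0.cls R (HomEnd R M N'')) := by
  have h1 := K0.cls_eq_add (HomEnd.map i) (HomEnd.map q).rangeRestrict
    (fun φ ψ h ↦ (LinearMap.cancel_left hi).1 h) (HomEnd.map q).surjective_rangeRestrict (by
      rw [LinearMap.ker_rangeRestrict]
      ext φ
      constructor
      · rintro ⟨ψ, rfl⟩
        ext x
        have h0 : i (ψ x) ∈ LinearMap.ker q := hiq ▸ LinearMap.mem_range_self i (ψ x)
        exact h0
      · intro hφ
        have hφ' (x : M) : φ x ∈ LinearMap.range i := hiq ▸ LinearMap.congr_fun hφ x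
        let e := LinearEquiv.ofInjective i hi
        exact ⟨e.symm.toLinearMap ∘ₗ φ.codRestrict _ hφ', LinearMap.ext fun x ↦
          congrArg Subtype.val (e.apply_symm_apply ⟨φ x, hφ' x⟩)⟩)
  rw [h1, QuotientAddGroup.mk_add, CMSubgroup.mk_cls_eq (LinearMap.range (HomEnd.map q)).subtype]
  · intro f m φ hφ
    rw [show φ = 0 from Subtype.ext hφ, smul_zero]
  · intro f m φ
    rw [Submodule.range_subtype]
    exact exists_comp_eq_smul hq f m φ

end Hom

/-- The coevaluation `X → Hom_{End_R(M)}(M, M ⊗ X)`. -/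
def HomEnd.coev (X : Type) [AddCommGroup X] [Module R X] : X →ₗ[R] HomEnd R M (M ⊗[R] X) where
  toFun x :=
    { toFun m := m ⊗ₜ x
      map_add' _ _ := TensorProduct.add_tmul _ _ _
      map_smul' _ _ := rfl }
  map_add' _ _ := LinearMap.ext fun _ ↦ TensorProduct.tmul_add _ _ _
  map_smul' _ _ := LinearMap.ext fun _ ↦ TensorProduct.tmul_smul _ _ _

lemma rankOne_smul_mem (X : Type) [AddCommGroup X] [Module R X] (f : M →ₗ[R] R) (z : M ⊗[R] X) :
    ∃ x : X, ∀ y : M, rankOne f y • z = y ⊗ₜ x := by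
  induction z using TensorProduct.induction_on with
  | zero => exact ⟨0, by simp⟩
  | tmul m x =>
    refine ⟨f m • x, fun y ↦ ?_⟩
    rw [TensorProduct.smul_tmul', TensorProduct.tmul_smul, TensorProduct.smul_tmul']
    rfl
  | add z w hz hw =>
    obtain ⟨x, hx⟩ := hz
    obtain ⟨x', hx'⟩ := hw
    exact ⟨x + x', fun y ↦ by rw [smul_add, hx, hx', TensorProduct.tmul_add]⟩

variable [IsNoetherianRing R] [Module.Finite R M]

lemma mk_cls_homEnd_tensor (X : Type) [AddCommGroup X] [Module R X] [Module.Finite R X] :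
    (QuotientAddGroup.mk (K0.cls R (HomEnd R M (M ⊗[R] X))) : K0 R ⧸ CMSubgroup R M) =
      QuotientAddGroup.mk (K0.cls R X) := by
  refine (CMSubgroup.mk_cls_eq (HomEnd.coev X) (fun f m x hx ↦ ?_) fun f m φ ↦ ?_).symm
  · have h0 : m ⊗ₜ[R] x = 0 := LinearMap.congr_fun hx m
    simpa using congrArg (TensorProduct.lift (LinearMap.lsmul R X ∘ₗ f)) h0
  · obtain ⟨x, hx⟩ := rankOne_smul_mem X f (φ m)
    refine ⟨x, LinearMap.ext fun y ↦ ?_⟩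
    rw [LinearMap.smul_apply, smul_apply_eq_rankOne_smul, hx]
    rfl

lemma exists_homEnd_hom : ∃ F : K0 (Module.End R M) →+ K0 R ⧸ CMSubgroup R M,
    ∀ (N : Type) [AddCommGroup N] [Module R N] [Module (Module.End R M) N]
      [IsScalarTower R (Module.End R M) N] [Module.Finite R N] [Module.Finite (Module.End R M) N],
      F (K0.cls (Module.End R M) N) = QuotientAddGroup.mk (K0.cls R (HomEnd R M N)) := by
  have : Module.Finite R (Module.End R M) := finite_linearMap
  let mod (N : FGModuleClass (Module.End R M)) : Module R N.1 :=
    Module.compHom N.1 (algebraMap R (Module.End R M))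
  have tower (N : FGModuleClass (Module.End R M)) : IsScalarTower R (Module.End R M) N.1 :=
    ⟨fun r a x ↦ by rw [Algebra.smul_def, mul_smul]; rfl⟩
  have fin (N : FGModuleClass (Module.End R M)) : Module.Finite R N.1 :=
    have := N.2
    Module.Finite.trans (Module.End R M) N.1
  let h : FreeAbelianGroup (FGModuleClass (Module.End R M)) →+ K0 R ⧸ CMSubgroup R M :=
    FreeAbelianGroup.lift fun N ↦ QuotientAddGroup.mk (K0.cls R (HomEnd R M N.1))
  refine ⟨QuotientAddGroup.lift _ h ?_, ?_⟩
  · refine (AddSubgroup.closure_le h.ker).2 ?_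
    rintro _ ⟨N', N, N'', i, q, hi, hq, hiq, rfl⟩
    rw [SetLike.mem_coe, AddMonoidHom.mem_ker, map_sub, map_sub]
    simp only [h, FreeAbelianGroup.lift_apply_of]
    rw [mk_cls_homEnd_eq_add i q hi hq hiq]
    abel
  · intro N _ inst _ _ _ hN
    have : inst = mod ⟨ModuleCat.of _ N, hN⟩ := by
      refine Module.ext' _ _ fun r x ↦ ?_
      rw [← algebraMap_smul (Module.End R M) r x]
      rfl
    subst this
    exact FreeAbelianGroup.lift_apply_of _ _

theorem exists_surjective_homEnd_hom :
    ∃ F : K0 (Module.End R M) →+ K0 R ⧸ CMSubgroup R M, Surjective F := by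
  obtain ⟨F, hF⟩ := exists_homEnd_hom (R := R) (M := M)
  refine ⟨F, ?_⟩
  have htop : F.range.comap (QuotientAddGroup.mk' (CMSubgroup R M)) = ⊤ :=
    K0.eq_top_of_cls_mem fun X _ _ _ ↦ by
      have : Module.Finite (Module.End R M) (M ⊗[R] X) :=
        Module.Finite.of_restrictScalars_finite R _ _
      exact ⟨K0.cls (Module.End R M) (M ⊗[R] X), (hF _).trans (mk_cls_homEnd_tensor X)⟩
  intro y
  obtain ⟨y, rfl⟩ := QuotientAddGroup.mk_surjective y
  exact (htop ▸ AddSubgroup.mem_top y : y ∈ F.range.comap _)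

end Comparison

/-- Let `R` be a noetherian semilocal ring and let `M` be a finitely generated faithful
`R`-module giving a non-commutative resolution, i.e. `End_R(M)` has finite global
dimension. Then `K₀(R)/⟨C_M⟩` is a finitely generated abelian group, where `C_M` is
the subcategory of finitely generated modules supported on `NG(M)`. -/
theorem statement8 (R : Type) [CommRing R] [IsNoetherianRing R]
    (hsemilocal : {I : Ideal R | I.IsMaximal}.Finite)
    (M : Type) [AddCommGroup M] [Module R M] [Module.Finite R M] [FaithfulSMul R M]
    (hNCR : HasFiniteGlobalDim (Module.End R M)) :
    AddGroup.FG (K0 R ⧸ CMSubgroup R M) := by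
  have : Module.Finite R (Module.End R M) := finite_linearMap
  have := K0.fg_of_hasFiniteGlobalDim hsemilocal hNCR
  obtain ⟨F, hF⟩ := exists_surjective_homEnd_hom (R := R) (M := M)
  exact AddGroup.fg_of_surjective hF
end

section
/- Let R be a commutative noetherian semilocal ring and M a finitely generated faithful R-module giving a non-commutative resolution (End_R(M) has finite global dimension). If M_p is a generator of mod R_p for all primes p outside a closed subscheme of Spec(R) of dimension at most one, then K_0(R) is a finitely generated abelian group. -/
open Function

namespace K0

section Basic

variable {A : Type} [Ring A]

/-- The class in `K0 A` of a finitely generated `A`-module. -/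
def cls_s10 (A : Type) [Ring A] (M : Type) [AddCommGroup M] [Module A M] [h : Module.Finite A M] :
    K0 A :=
  QuotientAddGroup.mk (FreeAbelianGroup.of ⟨ModuleCat.of A M, h⟩)

section

variable {M N P : Type} [AddCommGroup M] [AddCommGroup N] [AddCommGroup P]
  [Module A M] [Module A N] [Module A P]
  [Module.Finite A M] [Module.Finite A N] [Module.Finite A P]

theorem cls_eq_add_s10 (f : M →ₗ[A] N) (g : N →ₗ[A] P) (hf : Injective f) (hg : Surjective g)
    (hfg : Exact f g) : cls_s10 A N = cls_s10 A M + cls_s10 A P := by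
  unfold cls_s10
  rw [← sub_eq_zero, ← sub_sub, ← QuotientAddGroup.mk_sub, ← QuotientAddGroup.mk_sub,
    QuotientAddGroup.eq_zero_iff]
  exact AddSubgroup.subset_closure
    ⟨_, _, _, f, g, hf, hg, (LinearMap.exact_iff.mp hfg).symm, rfl⟩

theorem cls_of_subsingleton [Subsingleton M] : cls_s10 A M = 0 := by
  have h := cls_eq_add_s10 (A := A) (LinearMap.id : M →ₗ[A] M) (LinearMap.id : M →ₗ[A] M)
    injective_id surjective_id (fun x => by simp [Subsingleton.elim x 0])
  simpa using h

theorem cls_congr_s10 (e : M ≃ₗ[A] N) : cls_s10 A M = cls_s10 A N := by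
  have h := cls_eq_add_s10 (A := A) e.toLinearMap (0 : N →ₗ[A] PUnit.{1}) e.injective
    (fun x => ⟨0, Subsingleton.elim _ _⟩) (fun x => by simp)
  rw [h, cls_of_subsingleton (M := PUnit.{1}), add_zero]

theorem cls_prod_s10 : cls_s10 A (M × N) = cls_s10 A M + cls_s10 A N :=
  cls_eq_add_s10 _ _ LinearMap.inl_injective LinearMap.snd_surjective .inl_snd

end

theorem mem_of_forall_cls_mem {H : AddSubgroup (K0 A)}
    (h : ∀ (M : Type) [AddCommGroup M] [Module A M] [Module.Finite A M], cls_s10 A M ∈ H)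
    (x : K0 A) : x ∈ H := by
  induction x using QuotientAddGroup.induction_on with
  | H x =>
    induction x using FreeAbelianGroup.induction_on with
    | zero => exact H.zero_mem
    | of M => have := M.2; exact h M.1
    | neg M ih => exact H.neg_mem ih
    | add x y hx hy => exact H.add_mem hx hy

/-- A function on finitely generated modules that is additive on short exact sequences
induces a homomorphism on `K0`. -/
def lift {G : Type*} [AddCommGroup G] (φ : FGModuleClass A → G)
    (hφ : ∀ (M N P : FGModuleClass A) (f : M.1 →ₗ[A] N.1) (g : N.1 →ₗ[A] P.1),
      Injective f → Surjective g → Exact f g → φ N = φ M + φ P) : K0 A →+ G :=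
  QuotientAddGroup.lift _ (FreeAbelianGroup.lift φ) <| by
    rw [K0Relations, AddSubgroup.closure_le]
    rintro _ ⟨M, N, P, f, g, hf, hg, hfg, rfl⟩
    have h := hφ M N P f g hf hg (LinearMap.exact_iff.mpr hfg.symm)
    simp [h]

@[simp]
theorem lift_cls {G : Type*} [AddCommGroup G] (φ : FGModuleClass A → G) (hφ)
    (M : Type) [AddCommGroup M] [Module A M] [h : Module.Finite A M] :
    lift φ hφ (cls_s10 A M) = φ ⟨ModuleCat.of A M, h⟩ :=
  (QuotientAddGroup.lift_mk _ _ _).trans (FreeAbelianGroup.lift_apply_of _ _)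

end Basic

section Resolution

open CategoryTheory

variable {A : Type} [Ring A]

theorem _root_.ProjDimLE.hasProjectiveDimensionLE {n : ℕ} {M : ModuleCat.{0} A}
    (h : ProjDimLE A n M) : HasProjectiveDimensionLE M n := by
  induction h with
  | proj M h =>
    exact (projective_iff_hasProjectiveDimensionLE_zero _).mp ((IsProjective.iff_projective M).mp h)
  | step n M P hP f hf h ih =>
    exact ((LinearMap.shortExact_shortComplexKer hf).hasProjectiveDimensionLT_X₃_iff n
      ((IsProjective.iff_projective P).mp hP)).mpr ih

/-- The classes of finitely generated projective modules generate `K0 A` when `A` is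
left noetherian of finite global dimension. -/
theorem mem_of_forall_projective_cls_mem [IsNoetherianRing A] (hA : HasFiniteGlobalDim A)
    {H : AddSubgroup (K0 A)}
    (h : ∀ (P : Type) [AddCommGroup P] [Module A P] [Module.Finite A P] [Module.Projective A P],
      cls_s10 A P ∈ H)
    (x : K0 A) : x ∈ H := by
  obtain ⟨n, hn⟩ := hA
  refine mem_of_forall_cls_mem (fun M _ _ _ => ?_) x
  have hM := (hn (ModuleCat.of A M)).hasProjectiveDimensionLE
  clear hn
  induction n generalizing M with
  | zero =>
    have : Module.Projective A M := (IsProjective.iff_projective M).mpr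
      ((projective_iff_hasProjectiveDimensionLE_zero _).mpr hM)
    exact h M
  | succ n ih =>
    obtain ⟨k, f, hf⟩ := Module.Finite.exists_fin' A M
    have hK : HasProjectiveDimensionLE (ModuleCat.of A (LinearMap.ker f)) n :=
      ((LinearMap.shortExact_shortComplexKer hf).hasProjectiveDimensionLT_X₃_iff n
        ((IsProjective.iff_projective (Fin k → A)).mp inferInstance)).mp hM
    have hcls := cls_eq_add_s10 _ f (Submodule.subtype_injective _) hf
      (LinearMap.exact_subtype_ker_map f)
    rw [← sub_eq_iff_eq_add'] at hcls
    rw [← hcls]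
    exact H.sub_mem (h _) (ih _ inferInstance inferInstance inferInstance hK)

end Resolution

end K0

section HomLength

variable {R A : Type} [CommRing R] [Ring A] [Algebra R A]
variable {N N' T : Type} [AddCommGroup N] [AddCommGroup N'] [AddCommGroup T]
  [Module A N] [Module A N'] [Module A T] [Module R T] [IsScalarTower R A T]

theorem LinearMap.nonempty_linearEquiv_ker_prod (f : N →ₗ[A] T)
    (h : ∃ l : T →ₗ[A] N, f ∘ₗ l = LinearMap.id) :
    Nonempty (N ≃ₗ[A] LinearMap.ker f × T) := by
  obtain ⟨l, hl⟩ := h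
  exact ⟨((LinearMap.exact_subtype_ker_map f).splitSurjectiveEquiv
    (Submodule.subtype_injective _) ⟨l, hl⟩).1⟩

variable (R T) in
theorem length_hom_congr (e : N ≃ₗ[A] N') :
    Module.length R (N →ₗ[A] T) = Module.length R (N' →ₗ[A] T) :=
  (LinearEquiv.congrLeft T R e).length_eq

variable (R A N N' T) in
theorem length_hom_prod :
    Module.length R (N × N' →ₗ[A] T) =
      Module.length R (N →ₗ[A] T) + Module.length R (N' →ₗ[A] T) := by
  rw [← (LinearMap.coprodEquiv R (M := N) (M₂ := N') (M₃ := T) (R := A)).length_eq,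
    Module.length_prod]

variable (R A N T) in
/-- Evaluation at a finite generating family embeds `Hom_A(N, T)` into a power of `T`. -/
theorem exists_injective_hom_pi [Module.Finite A N] :
    ∃ (k : ℕ) (φ : (N →ₗ[A] T) →ₗ[R] (Fin k → T)), Injective φ := by
  obtain ⟨k, f, hf⟩ := Module.Finite.exists_fin' A N
  refine ⟨k, { toFun := fun g i => g (f (Pi.single i 1)), map_add' := fun _ _ => rfl,
               map_smul' := fun _ _ => rfl }, fun g g' h => ?_⟩
  have h' : g ∘ₗ f = g' ∘ₗ f := by
    refine LinearMap.pi_ext' fun i => LinearMap.ext_ring ?_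
    exact congrFun h i
  ext x
  obtain ⟨y, rfl⟩ := hf x
  exact LinearMap.congr_fun h' y

variable (R A N T) in
theorem length_hom_ne_top [Module.Finite A N] [IsArtinian R T] [IsNoetherian R T] :
    Module.length R (N →ₗ[A] T) ≠ ⊤ := by
  obtain ⟨k, φ, hφ⟩ := exists_injective_hom_pi R A N T
  have := isArtinian_of_injective φ hφ
  have := isNoetherian_of_injective φ hφ
  exact Module.length_ne_top

theorem length_hom_quotient_jacobson [IsSimpleModule A T] :
    Module.length R ((N ⧸ Module.jacobson A N) →ₗ[A] T) = Module.length R (N →ₗ[A] T) := by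
  refine (LinearEquiv.ofBijective
    ({ toFun := fun g => g ∘ₗ (Module.jacobson A N).mkQ, map_add' := fun _ _ => rfl,
       map_smul' := fun _ _ => rfl } :
      ((N ⧸ Module.jacobson A N) →ₗ[A] T) →ₗ[R] (N →ₗ[A] T))
    ⟨fun g g' h => ?_, fun g => ?_⟩).length_eq
  · exact Submodule.linearMap_qext _ h
  · have hg : Module.jacobson A N ≤ LinearMap.ker g := by
      have := Module.le_comap_jacobson g
      rwa [IsSemisimpleModule.jacobson_eq_bot A T] at this
    exact ⟨(Module.jacobson A N).liftQ g hg, Submodule.liftQ_mkQ _ _ _⟩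

theorem exists_isSimpleModule_quotient_of_nontrivial [Module.Finite A N] [Nontrivial N] :
    ∃ m : Submodule A N, IsSimpleModule A (N ⧸ m) := by
  obtain ⟨m, hm, -⟩ := (eq_top_or_exists_le_coatom (⊥ : Submodule A N)).resolve_left bot_ne_top
  exact ⟨m, isSimpleModule_iff_isCoatom.mpr hm⟩

variable {ι : Type} (S : ι → Type) [∀ i, AddCommGroup (S i)] [∀ i, Module A (S i)]
  [∀ i, Module R (S i)] [∀ i, IsScalarTower R A (S i)] [∀ i, IsSimpleModule A (S i)]
  (hS : ∀ (T : Type) [AddCommGroup T] [Module A T] [IsSimpleModule A T],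
    ∃ i, Nonempty (T ≃ₗ[A] S i))

include hS

variable (R) in
theorem subsingleton_of_length_hom_eq_zero [Module.Finite A N]
    (h : ∀ i, Module.length R (N →ₗ[A] S i) = 0) : Subsingleton N := by
  by_contra hN
  rw [not_subsingleton_iff_nontrivial] at hN
  obtain ⟨m, hm⟩ := exists_isSimpleModule_quotient_of_nontrivial (A := A) (N := N)
  obtain ⟨i, ⟨e⟩⟩ := hS (N ⧸ m)
  have hsub := Module.length_eq_zero_iff.mp (h i)
  have h0 : e.toLinearMap ∘ₗ m.mkQ = 0 := Subsingleton.elim _ _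
  have := IsSimpleModule.nontrivial A (S i)
  obtain ⟨x, hx⟩ := exists_ne (0 : S i)
  obtain ⟨y, hy⟩ := (e.surjective.comp m.mkQ_surjective) x
  exact hx (hy ▸ LinearMap.congr_fun h0 y)

variable [∀ i, IsArtinian R (S i)] [∀ i, IsNoetherian R (S i)]

/-- Finitely generated semisimple modules are determined by the lengths of the spaces of
homomorphisms to the simple modules. -/
theorem nonempty_linearEquiv_of_semisimple_of_length_hom_eq
    [IsSemisimpleModule A N] [IsSemisimpleModule A N'] [Module.Finite A N] [Module.Finite A N']
    (h : ∀ i, Module.length R (N →ₗ[A] S i) = Module.length R (N' →ₗ[A] S i)) :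
    Nonempty (N ≃ₗ[A] N') := by
  obtain ⟨n, hn⟩ : ∃ n : ℕ, Module.length A N ≤ n := by
    have : IsNoetherian A N := inferInstance
    have : IsArtinian A N := inferInstance
    exact ⟨_, (ENat.natCast_toNat (Module.length_ne_top (R := A) (M := N))).ge⟩
  induction n generalizing N N' with
  | zero =>
    have : Subsingleton N := Module.length_eq_zero_iff.mp (by simpa using hn)
    have : Subsingleton N' := subsingleton_of_length_hom_eq_zero R S hS fun i => by
      rw [← h i, Module.length_eq_zero_iff]
      infer_instance
    exact ⟨0⟩
  | succ n ih =>
    rcases subsingleton_or_nontrivial N with hN | hN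
    · have : Subsingleton N' := subsingleton_of_length_hom_eq_zero R S hS fun i => by
        rw [← h i, Module.length_eq_zero_iff]
        infer_instance
      exact ⟨0⟩
    obtain ⟨m, hm⟩ := exists_isSimpleModule_quotient_of_nontrivial (A := A) (N := N)
    obtain ⟨i, ⟨e⟩⟩ := hS (N ⧸ m)
    have key : ∀ (L : Type) [AddCommGroup L] [Module A L] [IsSemisimpleModule A L]
        (f : L →ₗ[A] S i), f ≠ 0 → Nonempty (L ≃ₗ[A] LinearMap.ker f × S i) :=
      fun L _ _ _ f hf => f.nonempty_linearEquiv_ker_prod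
        (IsSemisimpleModule.lifting_property f (LinearMap.surjective_of_ne_zero hf) _)
    have := IsSimpleModule.nontrivial A (S i)
    have hf : e.toLinearMap ∘ₗ m.mkQ ≠ 0 := by
      intro h0
      obtain ⟨x, hx⟩ := exists_ne (0 : S i)
      obtain ⟨y, hy⟩ := (e.surjective.comp m.mkQ_surjective) x
      exact hx (hy ▸ LinearMap.congr_fun h0 y)
    obtain ⟨f', hf'⟩ : ∃ f' : N' →ₗ[A] S i, f' ≠ 0 := by
      by_contra! hall
      have h1 : Module.length R (N →ₗ[A] S i) = 0 := by
        rw [h i, Module.length_eq_zero_iff]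
        exact ⟨fun a b => by rw [hall a, hall b]⟩
      rw [Module.length_eq_zero_iff] at h1
      exact hf (Subsingleton.elim _ _)
    obtain ⟨a⟩ := key N _ hf
    obtain ⟨b⟩ := key N' _ hf'
    have hlen : Module.length A (LinearMap.ker (e.toLinearMap ∘ₗ m.mkQ)) ≤ n := by
      rw [a.length_eq, Module.length_prod, Module.length_eq_one A (S i)] at hn
      exact (ENat.add_le_add_iff_right ENat.one_ne_top).mp (by exact_mod_cast hn)
    obtain ⟨c⟩ := ih (N := LinearMap.ker (e.toLinearMap ∘ₗ m.mkQ)) (N' := LinearMap.ker f')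
      (fun j => by
        have hj := h j
        rw [length_hom_congr R (S j) a, length_hom_congr R (S j) b, length_hom_prod,
          length_hom_prod] at hj
        exact ENat.add_left_injective_of_ne_top (length_hom_ne_top R A (S i) (S j)) hj) hlen
    exact ⟨a.trans ((c.prodCongr (.refl A _)).trans b.symm)⟩

/-- Over a semilocal ring, finitely generated projective modules are determined by the lengths
of the spaces of homomorphisms to the simple modules. -/
theorem nonempty_linearEquiv_of_projective_of_length_hom_eq
    [IsSemisimpleModule A (A ⧸ Module.jacobson A A)]
    [Module.Projective A N] [Module.Projective A N'] [Module.Finite A N] [Module.Finite A N']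
    (h : ∀ i, Module.length R (N →ₗ[A] S i) = Module.length R (N' →ₗ[A] S i)) :
    Nonempty (N ≃ₗ[A] N') := by
  have semisimple : ∀ (L : Type) [AddCommGroup L] [Module A L] [Module.Finite A L],
      IsSemisimpleModule A (L ⧸ Module.jacobson A L) := by
    intro L _ _ _
    obtain ⟨k, f, hf⟩ := Module.Finite.exists_fin' A L
    let J := Module.jacobson A A
    let q := (Module.jacobson A L).mkQ ∘ₗ f
    have hJ : ∀ i, J ≤ LinearMap.ker (q ∘ₗ LinearMap.single A (fun _ : Fin k => A) i) := by
      intro i x hx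
      rw [LinearMap.mem_ker, LinearMap.comp_apply, LinearMap.comp_apply, Submodule.mkQ_apply,
        Submodule.Quotient.mk_eq_zero]
      exact Module.le_comap_jacobson (f ∘ₗ LinearMap.single A (fun _ : Fin k => A) i) hx
    refine IsSemisimpleModule.of_surjective
      (LinearMap.lsum A (fun _ : Fin k => A ⧸ J) ℕ fun i => J.liftQ _ (hJ i)) fun y => ?_
    obtain ⟨x, rfl⟩ := ((Submodule.mkQ_surjective _).comp hf) y
    refine ⟨fun i => J.mkQ (x i), ?_⟩
    simp only [LinearMap.lsum_apply, LinearMap.sum_apply, LinearMap.comp_apply,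
      LinearMap.proj_apply, Submodule.mkQ_apply, Submodule.liftQ_apply]
    rw [← map_sum]
    simp [q, Finset.univ_sum_single]
  have := semisimple N
  have := semisimple N'
  obtain ⟨e⟩ := nonempty_linearEquiv_of_semisimple_of_length_hom_eq (R := R) S hS
    (N := N ⧸ Module.jacobson A N) (N' := N' ⧸ Module.jacobson A N')
    (fun i => by rw [length_hom_quotient_jacobson, length_hom_quotient_jacobson, h i])
  obtain ⟨f, hf⟩ := Module.projective_lifting_property (Module.jacobson A N').mkQ
    (e.toLinearMap ∘ₗ (Module.jacobson A N).mkQ) (Submodule.mkQ_surjective _)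
  have hsurj : Surjective f := by
    rw [← LinearMap.range_eq_top]
    refine (eq_top_or_exists_le_coatom _).resolve_right ?_
    rintro ⟨m, hm, hle⟩
    refine hm.1 (eq_top_iff.mpr fun y _ => ?_)
    obtain ⟨x, hx⟩ := (e.surjective.comp (Submodule.mkQ_surjective _))
      ((Module.jacobson A N').mkQ y)
    have hxy : f x - y ∈ Module.jacobson A N' := by
      rw [← Submodule.Quotient.mk_eq_zero, Submodule.Quotient.mk_sub, sub_eq_zero]
      exact (LinearMap.congr_fun hf x).trans hx
    have h1 : f x - y ∈ m := (sInf_le hm : Module.jacobson A N' ≤ m) hxy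
    exact (Submodule.sub_mem_iff_right _ (hle ⟨x, rfl⟩)).mp h1
  obtain ⟨a⟩ := f.nonempty_linearEquiv_ker_prod (Module.projective_lifting_property f _ hsurj)
  have : Module.Finite A (LinearMap.ker f) :=
    .of_surjective (LinearMap.fst A (LinearMap.ker f) N' ∘ₗ a.toLinearMap)
      ((LinearMap.fst_surjective (R := A) (M := LinearMap.ker f) (M₂ := N')).comp a.surjective)
  have hker : Subsingleton (LinearMap.ker f) :=
    subsingleton_of_length_hom_eq_zero R S hS fun i => by
      have hi := h i
      rw [length_hom_congr R (S i) a, length_hom_prod] at hi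
      exact ENat.add_left_injective_of_ne_top (length_hom_ne_top R A N' (S i))
        (hi.trans (zero_add _).symm)
  have hinj : Injective f :=
    LinearMap.ker_eq_bot.mp ((Submodule.subsingleton_iff_eq_bot).mp hker)
  exact ⟨.ofBijective f ⟨hinj, hsurj⟩⟩

end HomLength

section Semilocal

variable {R A : Type} [CommRing R] [Ring A] [Algebra R A]

theorem K0.fg_of_hasFiniteGlobalDim_s10 {ι : Type} [Finite ι] (S : ι → Type)
    [∀ i, AddCommGroup (S i)] [∀ i, Module A (S i)]
    [∀ i, Module R (S i)] [∀ i, IsScalarTower R A (S i)] [∀ i, IsSimpleModule A (S i)]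
    [∀ i, IsArtinian R (S i)] [∀ i, IsNoetherian R (S i)]
    (hS : ∀ (T : Type) [AddCommGroup T] [Module A T] [IsSimpleModule A T],
      ∃ i, Nonempty (T ≃ₗ[A] S i))
    [IsNoetherianRing A] [IsSemisimpleModule A (A ⧸ Module.jacobson A A)]
    (hA : HasFiniteGlobalDim A) : AddGroup.FG (K0 A) := by
  let Pr := {P : FGModuleClass A // Module.Projective A P.1}
  have fin (P : Pr) : Module.Finite A P.1.1 := P.1.2
  have proj (P : Pr) : Module.Projective A P.1.1 := P.2
  let π : FreeAbelianGroup Pr →+ K0 A := FreeAbelianGroup.lift fun P => K0.cls_s10 A P.1.1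
  let v : FreeAbelianGroup Pr →+ (ι → ℤ) := FreeAbelianGroup.lift fun P i =>
    ((Module.length R (P.1.1 →ₗ[A] S i)).toNat : ℤ)
  let mk (P : Type) [AddCommGroup P] [Module A P] [hf : Module.Finite A P]
    [hp : Module.Projective A P] : Pr := ⟨⟨ModuleCat.of A P, hf⟩, hp⟩
  have hadd (P Q : Pr) : ∃ T : Pr, π (.of P) + π (.of Q) = π (.of T) ∧
      v (.of P) + v (.of Q) = v (.of T) := by
    refine ⟨mk (P.1.1 × Q.1.1), ?_, ?_⟩
    · simp only [π, FreeAbelianGroup.lift_apply_of]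
      exact K0.cls_prod_s10.symm
    · simp only [v, FreeAbelianGroup.lift_apply_of]
      ext i
      have h := length_hom_prod R A P.1.1 Q.1.1 (S i)
      have h' := congrArg ENat.toNat h
      rw [ENat.toNat_add (length_hom_ne_top R A _ _) (length_hom_ne_top R A _ _)] at h'
      change ((_ : ℕ) : ℤ) + ((_ : ℕ) : ℤ) =
        ((Module.length R (P.1.1 × Q.1.1 →ₗ[A] S i)).toNat : ℤ)
      exact_mod_cast h'.symm
  have diff (x : FreeAbelianGroup Pr) : ∃ P Q : Pr,
      π x = π (.of P) - π (.of Q) ∧ v x = v (.of P) - v (.of Q) := by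
    induction x using FreeAbelianGroup.induction_on with
    | zero => exact ⟨mk A, mk A, by simp, by simp⟩
    | of P =>
      obtain ⟨T, h1, h2⟩ := hadd P (mk A)
      exact ⟨T, mk A, by rw [← h1, add_sub_cancel_right], by rw [← h2, add_sub_cancel_right]⟩
    | neg P ih =>
      obtain ⟨P₁, Q₁, h1, h2⟩ := ih
      exact ⟨Q₁, P₁, by rw [map_neg, h1, neg_sub], by rw [map_neg, h2, neg_sub]⟩
    | add x y hx hy =>
      obtain ⟨P₁, Q₁, h1, h2⟩ := hx
      obtain ⟨P₂, Q₂, h3, h4⟩ := hy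
      obtain ⟨P, h5, h6⟩ := hadd P₁ P₂
      obtain ⟨Q, h7, h8⟩ := hadd Q₁ Q₂
      refine ⟨P, Q, ?_, ?_⟩
      · rw [map_add, h1, h3, ← h5, ← h7]; abel
      · rw [map_add, h2, h4, ← h6, ← h8]; abel
  have hker : v.ker ≤ π.ker := by
    intro x hx
    obtain ⟨P, Q, h1, h2⟩ := diff x
    rw [AddMonoidHom.mem_ker] at hx ⊢
    rw [hx, eq_comm, sub_eq_zero] at h2
    rw [h1, sub_eq_zero]
    simp only [v, π, FreeAbelianGroup.lift_apply_of] at h2 ⊢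
    obtain ⟨e⟩ := nonempty_linearEquiv_of_projective_of_length_hom_eq (R := R) S hS
      (N := P.1.1) (N' := Q.1.1) fun i => by
        have := congrFun h2 i
        rw [Nat.cast_inj] at this
        rw [← ENat.natCast_toNat (length_hom_ne_top R A P.1.1 (S i)), this,
          ENat.natCast_toNat (length_hom_ne_top R A Q.1.1 (S i))]
    exact K0.cls_congr_s10 e
  have hrange : AddGroup.FG v.range := by
    rw [← Module.Finite.iff_addGroup_fg]
    exact inferInstanceAs (Module.Finite ℤ (LinearMap.range v.toIntLinearMap))
  have hquot : AddGroup.FG (FreeAbelianGroup Pr ⧸ v.ker) :=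
    AddGroup.fg_of_surjective (f := (QuotientAddGroup.quotientKerEquivRange v).symm.toAddMonoidHom)
      (QuotientAddGroup.quotientKerEquivRange v).symm.surjective
  refine AddGroup.fg_of_surjective (f := QuotientAddGroup.lift v.ker π hker) fun x => ?_
  refine K0.mem_of_forall_projective_cls_mem hA (H := AddMonoidHom.range
    (QuotientAddGroup.lift v.ker π hker)) (fun P _ _ _ _ => ?_) x
  exact ⟨QuotientAddGroup.mk (.of (mk P)), (QuotientAddGroup.lift_mk _ _ _).trans
    (FreeAbelianGroup.lift_apply_of _ _)⟩

theorem isArtinian_of_jacobson_smul_eq_zero [Finite (MaximalSpectrum R)]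
    {B : Type} [AddCommGroup B] [Module R B] [Module.Finite R B]
    (h : ∀ r ∈ Ring.jacobson R, ∀ b : B, r • b = 0) : IsArtinian R B := by
  have hJ : IsArtinian R (R ⧸ Ring.jacobson R) := by
    have (m : MaximalSpectrum R) : IsArtinian R (R ⧸ m.asIdeal) := by
      have : IsSimpleModule R (R ⧸ m.asIdeal) :=
        isSimpleModule_iff_isCoatom.mpr (Ideal.isMaximal_def.mp m.isMaximal)
      infer_instance
    refine isArtinian_of_injective ((Ring.jacobson R).liftQ
      (LinearMap.pi fun m : MaximalSpectrum R => m.asIdeal.mkQ) ?_) ?_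
    · intro r hr
      ext m
      have := m.isMaximal
      exact (Submodule.Quotient.mk_eq_zero _).mpr (Ring.jacobson_le_of_isMaximal m.asIdeal hr)
    · rw [← LinearMap.ker_eq_bot]
      refine Submodule.ker_liftQ_eq_bot _ _ _ fun r hr => ?_
      rw [Ring.jacobson_eq_sInf_isMaximal, Submodule.mem_sInf]
      intro m hm
      exact (Submodule.Quotient.mk_eq_zero _).mp (congrFun hr ⟨m, hm⟩)
  obtain ⟨k, f, hf⟩ := Module.Finite.exists_fin' R B
  refine isArtinian_of_surjective (Fin k → R ⧸ Ring.jacobson R)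
    (LinearMap.lsum R (fun _ : Fin k => R ⧸ Ring.jacobson R) ℕ fun i =>
      (Ring.jacobson R).liftQ (LinearMap.toSpanSingleton R B (f (Pi.single i 1)))
        fun r hr => h r hr _) fun y => ?_
  obtain ⟨x, rfl⟩ := hf y
  refine ⟨fun i => (Ring.jacobson R).mkQ (x i), ?_⟩
  conv_rhs => rw [← Finset.univ_sum_single x, map_sum]
  simp only [LinearMap.lsum_apply, LinearMap.sum_apply, LinearMap.comp_apply,
    LinearMap.proj_apply]
  refine Finset.sum_congr rfl fun i _ => ?_
  change x i • f (Pi.single i 1) = _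
  rw [← map_smul, ← Pi.single_smul, smul_eq_mul, mul_one]

theorem algebraMap_mem_jacobson [Module.Finite R A] {r : R} (hr : r ∈ Ring.jacobson R) :
    algebraMap R A r ∈ Module.jacobson A A := by
  refine Submodule.mem_sInf.mpr fun L hL => ?_
  by_contra hrL
  let rA : Submodule A A := LinearMap.range (Algebra.lsmul R A A r)
  have hsup : L ⊔ rA = ⊤ := hL.2 _ (left_lt_sup.mpr fun hle =>
    hrL (hle ⟨1, by simp [Algebra.smul_def]⟩))
  have hle : (⊤ : Submodule R A) ≤ L.restrictScalars R := by
    refine Submodule.le_of_le_smul_of_le_jacobson_bot (I := Ring.jacobson R)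
      Module.Finite.fg_top (Ideal.jacobson_bot.ge) fun a _ => ?_
    obtain ⟨x, hx, _, ⟨b, rfl⟩, hxb⟩ := Submodule.mem_sup.mp (hsup ▸ Submodule.mem_top : a ∈ L ⊔ rA)
    rw [← hxb]
    exact Submodule.add_mem_sup hx (Submodule.smul_mem_smul hr Submodule.mem_top)
  exact hL.1 (eq_top_iff.mpr fun a ha => hle ha)

variable (R A) in
theorem isArtinian_quotient_jacobson [Finite (MaximalSpectrum R)] [Module.Finite R A] :
    IsArtinian R (A ⧸ Module.jacobson A A) :=
  isArtinian_of_jacobson_smul_eq_zero fun r hr b => by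
    obtain ⟨a, rfl⟩ := Submodule.mkQ_surjective _ b
    rw [Submodule.mkQ_apply, ← Submodule.Quotient.mk_smul, Submodule.Quotient.mk_eq_zero,
      Algebra.smul_def, Algebra.commutes]
    exact Submodule.smul_mem _ a (algebraMap_mem_jacobson hr)

/-- If `A` is a module-finite algebra of finite global dimension over a semilocal noetherian
commutative ring, then `K0 A` is finitely generated. -/
theorem K0.fg_of_moduleFinite [IsNoetherianRing R] [Finite (MaximalSpectrum R)]
    [Module.Finite R A] (hA : HasFiniteGlobalDim A) : AddGroup.FG (K0 A) := by
  have : IsNoetherianRing A := IsNoetherianRing.of_finite R A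
  let B := A ⧸ Module.jacobson A A
  have : IsArtinian R B := isArtinian_quotient_jacobson R A
  have : IsArtinian A B := isArtinian_of_tower R inferInstance
  have : IsSemisimpleModule A B := (IsArtinian.isSemisimpleModule_iff_jacobson A B).mpr
    (Module.jacobson_quotient_jacobson A A)
  obtain ⟨n, S, e, hsimple⟩ := IsSemisimpleModule.exists_linearEquiv_fin_dfinsupp A B
  have (i : Fin n) : IsArtinian R (S i) :=
    isArtinian_of_injective ((S i).subtype.restrictScalars R) (S i).subtype_injective
  have (i : Fin n) : IsNoetherian R (S i) :=
    isNoetherian_of_injective ((S i).subtype.restrictScalars R) (S i).subtype_injective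
  refine K0.fg_of_hasFiniteGlobalDim_s10 (R := R) (fun i => S i) (fun T _ _ _ => ?_) hA
  have := IsSimpleModule.nontrivial A T
  obtain ⟨t, ht⟩ := exists_ne (0 : T)
  have hle : Module.jacobson A A ≤ LinearMap.ker (LinearMap.toSpanSingleton A T t) := by
    have := Module.le_comap_jacobson (LinearMap.toSpanSingleton A T t)
    rwa [IsSemisimpleModule.jacobson_eq_bot A T] at this
  let g : B →ₗ[A] T := (Module.jacobson A A).liftQ _ hle
  have hg : g ∘ₗ e.symm.toLinearMap ≠ 0 := by
    intro h0
    have := LinearMap.congr_fun h0 (e ((Module.jacobson A A).mkQ 1))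
    rw [LinearMap.comp_apply, LinearEquiv.coe_coe, e.symm_apply_apply, Submodule.mkQ_apply,
      Submodule.liftQ_apply, LinearMap.toSpanSingleton_apply, one_smul] at this
    exact ht this
  obtain ⟨i, hi⟩ : ∃ i, (g ∘ₗ e.symm.toLinearMap) ∘ₗ DFinsupp.lsingle i ≠ 0 := by
    by_contra! hall
    exact hg (DFinsupp.lhom_ext' fun i => by rw [hall i, LinearMap.zero_comp])
  exact ⟨i, ⟨(LinearEquiv.ofBijective _ (LinearMap.bijective_of_ne_zero hi)).symm⟩⟩

end Semilocal

section Devissage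

variable {R : Type} [CommRing R] [IsNoetherianRing R]

/-- The subgroup of `K0 R` generated by the classes `[R ⧸ p]` with `p` in the closed set
`V(s)`. -/
def K0.supported (s : Set R) : AddSubgroup (K0 R) :=
  AddSubgroup.closure ((fun p : PrimeSpectrum R => K0.cls_s10 R (R ⧸ p.asIdeal)) ''
    PrimeSpectrum.zeroLocus s)

theorem K0.cls_mem_supported {s : Set R} {N : Type} [AddCommGroup N] [Module R N]
    [hfin : Module.Finite R N] (hN : ∀ r ∈ s, ∀ x : N, r • x = 0) :
    K0.cls_s10 R N ∈ K0.supported s := by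
  refine IsNoetherianRing.induction_on_isQuotientEquivQuotientPrime R hfin
    (motive := fun N _ _ _ => (∀ r ∈ s, ∀ x : N, r • x = 0) → K0.cls_s10 R N ∈ K0.supported s)
    (fun N _ _ _ _ _ => ?_) (fun N _ _ _ p e hN => ?_)
    (fun N₁ _ _ _ N₂ _ _ _ N₃ _ _ _ f g hf hg hfg h₁ h₃ hN => ?_) hN
  · rw [K0.cls_of_subsingleton]
    exact zero_mem _
  · rw [K0.cls_congr_s10 e]
    refine AddSubgroup.subset_closure ⟨p, fun r hr => ?_, rfl⟩
    have h := hN r hr (e.symm (Ideal.Quotient.mk _ 1))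
    rw [← map_smul, LinearEquiv.map_eq_zero_iff, Algebra.smul_def] at h
    exact Ideal.Quotient.eq_zero_iff_mem.mp (by simpa using h)
  · rw [K0.cls_eq_add_s10 f g hf hg hfg]
    refine add_mem (h₁ fun r hr x => hf ?_) (h₃ fun r hr x => ?_)
    · rw [map_smul, hN r hr, map_zero]
    · obtain ⟨y, rfl⟩ := hg x
      rw [← map_smul, hN r hr, map_zero]

theorem K0.cls_sub_cls_mem_supported {s : Set R} {X Y : Type} [AddCommGroup X] [AddCommGroup Y]
    [Module R X] [Module R Y] [Module.Finite R X] [Module.Finite R Y] (u : X →ₗ[R] Y)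
    (hker : ∀ r ∈ s, ∀ x, u x = 0 → r • x = 0) (hcoker : ∀ r ∈ s, ∀ y, ∃ x, u x = r • y) :
    K0.cls_s10 R X - K0.cls_s10 R Y ∈ K0.supported s := by
  have h₁ := K0.cls_eq_add_s10 _ u.rangeRestrict (LinearMap.ker u).subtype_injective
    u.surjective_rangeRestrict
    (LinearMap.exact_iff.mpr (by rw [LinearMap.ker_rangeRestrict, Submodule.range_subtype]))
  have h₂ := K0.cls_eq_add_s10 _ _ (LinearMap.range u).subtype_injective
    (LinearMap.range u).mkQ_surjective
    (LinearMap.exact_iff.mpr (by rw [Submodule.ker_mkQ, Submodule.range_subtype]))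
  rw [h₁, h₂, add_comm, add_sub_add_left_eq_sub]
  refine sub_mem (K0.cls_mem_supported fun r hr x => Subtype.ext (hker r hr _ x.2))
    (K0.cls_mem_supported fun r hr y => ?_)
  obtain ⟨y, rfl⟩ := Submodule.mkQ_surjective _ y
  rw [← map_smul, Submodule.mkQ_apply, Submodule.Quotient.mk_eq_zero]
  exact hcoker r hr y

end Devissage

section Trace

variable (R M : Type) [CommRing R] [IsNoetherianRing R] [AddCommGroup M] [Module R M]
  [Module.Finite R M]

/-- The set of values of linear forms on `M`; it generates the trace ideal of `M`. -/
def traceSet : Set R := {r | ∃ (f : M →ₗ[R] R) (m : M), f m = r}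

instance finite_linearMap_end {Y : Type} [AddCommGroup Y] [Module (Module.End R M) Y] [Module R Y]
    [IsScalarTower R (Module.End R M) Y] [Module.Finite (Module.End R M) Y] :
    Module.Finite R (M →ₗ[Module.End R M] Y) := by
  have : Module.Finite R Y := .trans (Module.End R M) Y
  have : Module.Finite (Module.End R M) M := .of_restrictScalars_finite R _ _
  obtain ⟨k, φ, hφ⟩ := exists_injective_hom_pi R (Module.End R M) M Y
  exact .of_injective φ hφ

/-- The class in `K0 R` of `Hom_A(M, Y)`, where `A = End_R(M)`. -/
def K0.homCls (Y : Type) [AddCommGroup Y] [Module (Module.End R M) Y]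
    [Module.Finite (Module.End R M) Y] : K0 R :=
  letI : Module R Y := Module.compHom Y (algebraMap R (Module.End R M))
  haveI : IsScalarTower R (Module.End R M) Y := .of_algebraMap_smul fun _ _ => rfl
  K0.cls_s10 R (M →ₗ[Module.End R M] Y)

theorem K0.homCls_eq (Y : Type) [AddCommGroup Y] [Module (Module.End R M) Y]
    [inst : Module R Y] [IsScalarTower R (Module.End R M) Y] [Module.Finite (Module.End R M) Y] :
    K0.homCls R M Y = K0.cls_s10 R (M →ₗ[Module.End R M] Y) := by
  have : inst = Module.compHom Y (algebraMap R (Module.End R M)) :=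
    Module.ext' _ _ fun r y => (algebraMap_smul (Module.End R M) r y).symm
  subst this
  rfl

variable {R M}

theorem K0.homCls_sub_mem_supported {Y₁ Y₂ Y₃ : Type} [AddCommGroup Y₁] [AddCommGroup Y₂]
    [AddCommGroup Y₃] [Module (Module.End R M) Y₁] [Module (Module.End R M) Y₂]
    [Module (Module.End R M) Y₃] [Module.Finite (Module.End R M) Y₁]
    [Module.Finite (Module.End R M) Y₂] [Module.Finite (Module.End R M) Y₃]
    (i : Y₁ →ₗ[Module.End R M] Y₂) (p : Y₂ →ₗ[Module.End R M] Y₃)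
    (hi : Injective i) (hp : Surjective p) (hip : Exact i p) :
    K0.homCls R M Y₂ - (K0.homCls R M Y₁ + K0.homCls R M Y₃) ∈
      K0.supported (traceSet R M) := by
  let : Module R Y₁ := Module.compHom Y₁ (algebraMap R (Module.End R M))
  let : Module R Y₂ := Module.compHom Y₂ (algebraMap R (Module.End R M))
  let : Module R Y₃ := Module.compHom Y₃ (algebraMap R (Module.End R M))
  have : IsScalarTower R (Module.End R M) Y₁ := .of_algebraMap_smul fun _ _ => rfl
  have : IsScalarTower R (Module.End R M) Y₂ := .of_algebraMap_smul fun _ _ => rfl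
  have : IsScalarTower R (Module.End R M) Y₃ := .of_algebraMap_smul fun _ _ => rfl
  rw [K0.homCls_eq, K0.homCls_eq, K0.homCls_eq]
  let I : (M →ₗ[Module.End R M] Y₁) →ₗ[R] (M →ₗ[Module.End R M] Y₂) :=
    { toFun g := i ∘ₗ g
      map_add' g h := LinearMap.comp_add _ _ _
      map_smul' r g := LinearMap.ext fun x => i.map_smul_of_tower r (g x) }
  let P : (M →ₗ[Module.End R M] Y₂) →ₗ[R] (M →ₗ[Module.End R M] Y₃) :=
    { toFun g := p ∘ₗ g
      map_add' g h := LinearMap.comp_add _ _ _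
      map_smul' r g := LinearMap.ext fun x => p.map_smul_of_tower r (g x) }
  have hI : Injective I := fun g h hgh => LinearMap.ext fun x => hi (LinearMap.congr_fun hgh x)
  have hIP : Exact I P.rangeRestrict := by
    intro g
    rw [← LinearMap.mem_ker, LinearMap.ker_rangeRestrict]
    refine ⟨fun hg => ?_, ?_⟩
    · let e := (LinearEquiv.ofInjective i hi).symm
      have hg' (x : M) : g x ∈ LinearMap.range i := (hip _).mp (LinearMap.congr_fun hg x)
      refine ⟨e.toLinearMap ∘ₗ g.codRestrict _ hg', LinearMap.ext fun x => ?_⟩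
      exact congrArg Subtype.val ((LinearEquiv.ofInjective i hi).apply_symm_apply ⟨g x, hg' x⟩)
    · rintro ⟨g, rfl⟩
      exact LinearMap.ext fun x => hip.apply_apply_eq_zero (g x)
  rw [K0.cls_eq_add_s10 I P.rangeRestrict hI P.surjective_rangeRestrict hIP, add_sub_add_left_eq_sub]
  refine K0.cls_sub_cls_mem_supported (LinearMap.range P).subtype
    (fun r _ x hx => ?_) ?_
  · rw [(Submodule.subtype_injective _) (hx.trans (map_zero _).symm), smul_zero]
  · rintro _ ⟨f, m, rfl⟩ g
    obtain ⟨y, hy⟩ := hp (g m)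
    let G : M →ₗ[Module.End R M] Y₂ :=
      { toFun x := (f.smulRight x : Module.End R M) • y
        map_add' x x' := by rw [← add_smul]; congr 1; ext; simp
        map_smul' a x := by
          rw [RingHom.id_apply, ← mul_smul]
          congr 1
          ext
          simp }
    refine ⟨⟨P G, G, rfl⟩, LinearMap.ext fun x => ?_⟩
    change p ((f.smulRight x : Module.End R M) • y) = f m • g x
    rw [map_smul, hy, ← map_smul, ← LinearMap.map_smul_of_tower g (f m) x]
    rfl

theorem K0.cls_sub_homCls_tensorProduct_mem_supported (X : Type) [AddCommGroup X] [Module R X]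
    [Module.Finite R X] [Module.Finite (Module.End R M) (TensorProduct R M X)] :
    K0.cls_s10 R X - K0.homCls R M (TensorProduct R M X) ∈ K0.supported (traceSet R M) := by
  rw [K0.homCls_eq]
  let u : X →ₗ[R] (M →ₗ[Module.End R M] TensorProduct R M X) :=
    { toFun x :=
        { toFun m := m ⊗ₜ[R] x
          map_add' m m' := TensorProduct.add_tmul _ _ _
          map_smul' a m := (TensorProduct.smul_tmul' a m x).symm }
      map_add' x x' := LinearMap.ext fun m => TensorProduct.tmul_add _ _ _
      map_smul' r x := LinearMap.ext fun m => TensorProduct.tmul_smul _ _ _ }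
  refine K0.cls_sub_cls_mem_supported u ?_ ?_
  · rintro _ ⟨f, m, rfl⟩ x hx
    have h : m ⊗ₜ[R] x = 0 := LinearMap.congr_fun hx m
    simpa using congrArg (fun t => TensorProduct.lid R X (f.rTensor X t)) h
  · rintro _ ⟨f, m, rfl⟩ g
    refine ⟨TensorProduct.lid R X (f.rTensor X (g m)), LinearMap.ext fun z => ?_⟩
    have key (t : TensorProduct R M X) :
        z ⊗ₜ[R] (TensorProduct.lid R X (f.rTensor X t)) = (f.smulRight z : Module.End R M) • t := by
      induction t with
      | zero => simp
      | tmul a x =>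
        rw [TensorProduct.smul_tmul', Module.End.smul_def]
        simp [TensorProduct.smul_tmul]
      | add t t' h h' => rw [map_add, map_add, TensorProduct.tmul_add, h, h', smul_add]
    change z ⊗ₜ[R] _ = f m • g z
    rw [key, ← map_smul, ← LinearMap.map_smul_of_tower g (f m) z]
    rfl

theorem K0.fg_of_fg_end (hA : AddGroup.FG (K0 (Module.End R M)))
    (hs : (PrimeSpectrum.zeroLocus (traceSet R M)).Finite) : AddGroup.FG (K0 R) := by
  let I := K0.supported (traceSet R M)
  let φ : K0 (Module.End R M) →+ K0 R ⧸ I :=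
    K0.lift (fun Y => haveI := Y.2; QuotientAddGroup.mk (K0.homCls R M Y.1))
      fun Y₁ Y₂ Y₃ i p hi hp hip => by
        have := Y₁.2
        have := Y₂.2
        have := Y₃.2
        rw [← QuotientAddGroup.mk_add, eq_comm, QuotientAddGroup.eq, neg_add_eq_sub]
        exact K0.homCls_sub_mem_supported i p hi hp hip
  have hφ : Surjective φ := by
    intro x
    obtain ⟨x, rfl⟩ := QuotientAddGroup.mk_surjective x
    refine K0.mem_of_forall_cls_mem (H := φ.range.comap (QuotientAddGroup.mk' I))
      (fun X _ _ _ => ?_) x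
    have : Module.Finite (Module.End R M) (TensorProduct R M X) :=
      .of_restrictScalars_finite R _ _
    refine ⟨K0.cls_s10 _ (TensorProduct R M X), ?_⟩
    rw [K0.lift_cls]
    refine QuotientAddGroup.eq.mpr ?_
    rw [neg_add_eq_sub]
    exact K0.cls_sub_homCls_tensorProduct_mem_supported X
  have hI : AddGroup.FG I :=
    (AddGroup.fg_iff_addSubgroup_fg I).mpr
      ⟨(hs.image fun p => K0.cls_s10 R (R ⧸ p.asIdeal)).toFinset, by simp [I, K0.supported]⟩
  have hQ : AddGroup.FG (K0 R ⧸ I) := AddGroup.fg_of_surjective hφ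
  rw [← Module.Finite.iff_addGroup_fg] at hI hQ ⊢
  have : Module.Finite ℤ (AddSubgroup.toIntSubmodule I) := hI
  have : Module.Finite ℤ (K0 R ⧸ AddSubgroup.toIntSubmodule I) := hQ
  exact Module.Finite.of_submodule_quotient (AddSubgroup.toIntSubmodule I)

end Trace

section Spectrum

variable {R : Type} [CommRing R] [IsNoetherianRing R]

theorem PrimeSpectrum.finite_of_topologicalKrullDim_le_one
    (hfin : {I : Ideal R | I.IsMaximal}.Finite) {Z : Set (PrimeSpectrum R)} (hZ : IsClosed Z)
    (hdim : topologicalKrullDim Z ≤ 1) : Z.Finite := by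
  obtain ⟨I, rfl⟩ := (PrimeSpectrum.isClosed_iff_zeroLocus_ideal Z).mp hZ
  have hsurj : Surjective (Ideal.Quotient.mk I) := Ideal.Quotient.mk_surjective
  have hrange := range_comap_of_surjective _ _ hsurj
  rw [Ideal.mk_ker] at hrange
  have hemb := (PrimeSpectrum.isClosedEmbedding_comap_of_surjective _ _ hsurj).isEmbedding
  rw [← hrange, ← hemb.toHomeomorph.isHomeomorph.topologicalKrullDim_eq,
    PrimeSpectrum.topologicalKrullDim_eq_ringKrullDim, ringKrullDim_quotient,
    Order.krullDim_le_one_iff] at hdim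
  refine Set.Finite.subset (((Ideal.finite_minimalPrimes_of_isNoetherianRing R I).union
    hfin).preimage (f := PrimeSpectrum.asIdeal) fun p _ q _ h => PrimeSpectrum.ext h) fun p hp => ?_
  rcases hdim ⟨p, hp⟩ with h | h
  · exact .inl ⟨⟨p.2, hp⟩, fun q hq hqp => h (b := ⟨⟨q, hq.1⟩, hq.2⟩) hqp⟩
  · obtain ⟨m, hm, hpm⟩ := p.asIdeal.exists_le_maximal p.2.ne_top
    have : m ≤ p.asIdeal := h (b := ⟨⟨m, hm.isPrime⟩, le_trans (α := Ideal R) hp hpm⟩) hpm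
    exact .inr (le_antisymm hpm this ▸ hm)

theorem exists_apply_notMem_of_surjective {M : Type} [AddCommGroup M] [Module R M]
    [Module.Finite R M] (p : Ideal R) [p.IsPrime] {n : ℕ}
    (f : (Fin n → LocalizedModule p.primeCompl M) →ₗ[Localization.AtPrime p]
      Localization.AtPrime p) (hf : Surjective f) :
    ∃ (F : M →ₗ[R] R) (m : M), F m ∉ p := by
  classical
  obtain ⟨x, hx⟩ := hf 1
  obtain ⟨i, hi⟩ : ∃ i, IsUnit (f (Pi.single i (x i))) := by
    by_contra! h
    have : f x ∈ IsLocalRing.maximalIdeal (Localization.AtPrime p) := by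
      rw [← Finset.univ_sum_single x, map_sum]
      exact sum_mem fun i _ => h i
    rw [hx] at this
    exact (Ideal.ne_top_iff_one _).mp (IsLocalRing.maximalIdeal.isMaximal _).ne_top this
  let g : LocalizedModule p.primeCompl M →ₗ[Localization.AtPrime p] Localization.AtPrime p :=
    f ∘ₗ LinearMap.single _ (fun _ => LocalizedModule p.primeCompl M) i
  obtain ⟨⟨m, t⟩, hm⟩ := IsLocalizedModule.mk'_surjective p.primeCompl
    (LocalizedModule.mkLinearMap p.primeCompl M) (x i)
  have hmt : t • x i = LocalizedModule.mkLinearMap p.primeCompl M m := by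
    rw [← hm]
    exact IsLocalizedModule.mk'_cancel' _ _ _
  have : Module.FinitePresentation R M := Module.finitePresentation_of_finite R M
  obtain ⟨F, s, hF⟩ := Module.FinitePresentation.exists_lift_of_isLocalizedModule p.primeCompl
    (Algebra.linearMap R (Localization.AtPrime p))
    (g.restrictScalars R ∘ₗ LocalizedModule.mkLinearMap p.primeCompl M)
  refine ⟨F, m, fun hFm => ?_⟩
  have h : algebraMap R (Localization.AtPrime p) (F m) =
      algebraMap R _ s.1 * algebraMap R _ t.1 * g (x i) := by
    have := LinearMap.congr_fun hF m
    change algebraMap R _ (F m) = s.1 • g (LocalizedModule.mkLinearMap p.primeCompl M m) at this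
    rw [this, ← hmt, Submonoid.smul_def, LinearMap.map_smul_of_tower, Algebra.smul_def,
      Algebra.smul_def, mul_assoc]
  have hu : IsUnit (algebraMap R (Localization.AtPrime p) (F m)) := by
    rw [h]
    exact ((IsLocalization.map_units _ s).mul (IsLocalization.map_units _ t)).mul hi
  exact (IsLocalization.AtPrime.isUnit_to_map_iff _ p _).mp hu hFm

end Spectrum

/-- Let `R` be a noetherian semilocal ring and `M` a finitely generated faithful
`R`-module giving a non-commutative resolution (`End_R(M)` has finite global
dimension).  If `M_p` is a generator of `mod R_p` for all primes `p` outside a closed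
subset of `Spec R` of dimension at most one, then `K₀(R)` is a finitely generated
abelian group. -/
theorem statement10 (R : Type) [CommRing R] [IsNoetherianRing R]
    (hsemilocal : {I : Ideal R | I.IsMaximal}.Finite)
    (M : Type) [AddCommGroup M] [Module R M] [Module.Finite R M] [FaithfulSMul R M]
    (hNCR : HasFiniteGlobalDim (Module.End R M))
    (Z : Set (PrimeSpectrum R)) (hZclosed : IsClosed Z)
    (hZdim : topologicalKrullDim Z ≤ 1)
    (hgen : ∀ p : PrimeSpectrum R, p ∉ Z →
      ∃ (n : ℕ) (f : (Fin n → LocalizedModule p.asIdeal.primeCompl M)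
          →ₗ[Localization.AtPrime p.asIdeal] Localization.AtPrime p.asIdeal),
        Surjective f) :
    AddGroup.FG (K0 R) := by
  have : Finite (MaximalSpectrum R) :=
    (MaximalSpectrum.equivSubtype R).finite_iff.mpr hsemilocal.to_subtype
  refine K0.fg_of_fg_end (K0.fg_of_moduleFinite (R := R) hNCR)
    ((PrimeSpectrum.finite_of_topologicalKrullDim_le_one hsemilocal hZclosed hZdim).subset
      fun p hp => ?_)
  by_contra hpZ
  obtain ⟨n, f, hf⟩ := hgen p hpZ
  obtain ⟨F, m, hm⟩ := exists_apply_notMem_of_surjective p.asIdeal f hf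
  exact hm (hp ⟨F, m, rfl⟩)
end
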